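/- Let N be an odd prime, α ∈ (0, 1/2), C ≥ 2, and let a₁ : ℤ_N → [0, ∞) satisfy Σ_{x∈ℤ_N} a₁(x) ≥ α and a₁(x) ≤ C/N for all x ∈ ℤ_N. Then there are constants C₂, C₃ > 0 depending only on C such that Λ₃(a₁, a₁, a₁) ≥ C₂ N^{−1} exp(−C₃ α^{−1} log⁵(1/α)). -/

import Mathlib

open Filter Real Set
open scoped Classical

structure Fc (c : ℝ) where
  x₀ : ℝ
  one_le_x₀ : 1 ≤ x₀
  toFun : ℝ → ℝ
  vth : ℝ → ℝ
  Ch : ℝ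
  Ch_pos : 0 < Ch
  one_le : ∀ x ≥ x₀, 1 ≤ toFun x
  contDiffOn : ContDiffOn ℝ 3 toFun (Set.Ici x₀)
  deriv_pos : ∀ x ≥ x₀, 0 < deriv toFun x
  deriv2_pos : ∀ x ≥ x₀, 0 < iteratedDeriv 2 toFun x
  vth_contDiffOn : ContDiffOn ℝ 2 vth (Set.Ici x₀)
  eqn : ∀ x ≥ x₀, toFun x = Ch * x ^ c * Real.exp (∫ t in x₀..x, vth t / t)
  cond_gt : 1 < c →
    Filter.Tendsto vth Filter.atTop (nhds 0) ∧
    Filter.Tendsto (fun x => x * deriv vth x) Filter.atTop (nhds 0) ∧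
    Filter.Tendsto (fun x => x ^ 2 * deriv (deriv vth) x) Filter.atTop (nhds 0)
  cond_eq : c = 1 →
    (∀ x ≥ x₀, 0 < vth x) ∧
    (∀ x y, x₀ ≤ x → x ≤ y → vth y ≤ vth x) ∧
    (∀ ε : ℝ, 0 < ε → ∃ C > 0, ∀ x ≥ x₀, 1 / vth x ≤ C * x ^ ε) ∧
    Filter.Tendsto (fun x => x / toFun x) Filter.atTop (nhds 0) ∧
    Filter.Tendsto vth Filter.atTop (nhds 0) ∧
    Filter.Tendsto (fun x => x * deriv vth x / vth x) Filter.atTop (nhds 0) ∧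
    Filter.Tendsto (fun x => x ^ 2 * deriv (deriv vth) x / vth x) Filter.atTop (nhds 0)

def Ph {c : ℝ} (F : Fc c) : Set ℕ :=
  {p : ℕ | p.Prime ∧ ∃ n : ℕ, F.x₀ ≤ (n : ℝ) ∧ (p : ℤ) = ⌊F.toFun n⌋}

noncomputable def e (t : ℝ) : ℂ := Complex.exp (2 * Real.pi * Complex.I * t)

/-- The measure `λ^h_{b,m,N}` on `Λ^h_{b,m,N} = {0 ≤ n ≤ N : mn + b ∈ P_h}`:
`λ^h_{b,m,N}(n) = ϕ(m) log(mn+b) / (m N φ'(mn+b))` there and `0` otherwise. -/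
noncomputable def lamh {c : ℝ} (F : Fc c) (φ : ℝ → ℝ) (b m N n : ℕ) : ℝ :=
  if n ≤ N ∧ m * n + b ∈ Ph F then
    (Nat.totient m : ℝ) * Real.log (m * n + b) / (m * N * deriv φ ((m * n + b : ℕ) : ℝ))
  else 0

/-- The Fourier transform on `ℤ_N` of a real-valued function (regarded on `{0, …, N-1}`):
`F_{ℤ_N}[f](ξ) = ∑_{x ∈ ℤ_N} f(x) e^{-2πiξx/N}`. -/
noncomputable def fourierZN (N : ℕ) (f : ℕ → ℝ) (ξ : ℕ) : ℂ :=
  ∑ n ∈ Finset.range N, (f n : ℂ) * e (-((ξ : ℝ) * n / N))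

/-- Convolution on `ℤ_N` (with `{0, …, N-1}` as a set of representatives):
`(f * g)(x) = ∑_{y ∈ ℤ_N} f(x - y) g(y)`. -/
noncomputable def convZN (N : ℕ) (f g : ℕ → ℝ) (x : ℕ) : ℝ :=
  ∑ y ∈ Finset.range N, f ((x + (N - y)) % N) * g y

/-- The distance of `t ∈ ℝ` to the nearest integer. -/
noncomputable def nint (t : ℝ) : ℝ := |t - round t|

/-- The trilinear form `Λ₃(f, g, h) = ∑_{x, d ∈ ℤ_N} f(x) g(x+d) h(x+2d)` on `ℤ_N`. -/
noncomputable def lam3 (N : ℕ) (f g h : ℕ → ℝ) : ℝ :=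
  ∑ x ∈ Finset.range N, ∑ d ∈ Finset.range N,
    f x * g ((x + d) % N) * h ((x + 2 * d) % N)

set_option linter.unusedSectionVars false


/-- indicator -/
noncomputable def ind {G : Type*} (A : Finset G) (x : G) : ℝ := if x ∈ A then 1 else 0

lemma ind_nonneg {G : Type*} (A : Finset G) (x : G) : 0 ≤ ind A x := by
  unfold ind; split_ifs <;> norm_num

lemma ind_le_one {G : Type*} (A : Finset G) (x : G) : ind A x ≤ 1 := by
  unfold ind; split_ifs <;> norm_num

lemma ind_mono {G : Type*} {A B : Finset G} (h : A ⊆ B) (x : G) : ind A x ≤ ind B x := by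
  unfold ind
  by_cases hx : x ∈ A
  · simp [hx, h hx]
  · simp only [hx, if_false]; split_ifs <;> norm_num

lemma sum_ind {G : Type*} [Fintype G] (A : Finset G) : ∑ x, ind A x = A.card := by
  simp [ind]

lemma sum_ind_mul {G : Type*} [Fintype G] (A : Finset G) (f : G → ℝ) :
    ∑ x, ind A x * f x = ∑ x ∈ A, f x := by
  simp [ind]

lemma sum_ind_mem {G : Type*} (A B : Finset G) :
    ∑ x ∈ B, ind A x = ((B.filter (fun x => x ∈ A)).card : ℝ) := by
  simp only [ind, Finset.sum_boole]

noncomputable def bohr {G : Type*} [AddCommGroup G] [Fintype G] (Γ : Finset (AddChar G ℂ)) (ρ : ℝ) :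
    Finset G :=
  Finset.univ.filter (fun x => ∀ γ ∈ Γ, ‖γ x - 1‖ ≤ ρ)

section bohr
variable {G : Type*} [AddCommGroup G] [Fintype G]

lemma mem_bohr {Γ : Finset (AddChar G ℂ)} {ρ : ℝ} {x : G} :
    x ∈ bohr Γ ρ ↔ ∀ γ ∈ Γ, ‖γ x - 1‖ ≤ ρ := by simp [bohr]

lemma norm_char_sub (γ : AddChar G ℂ) (x y : G) : ‖γ (x - y) - 1‖ = ‖γ x - γ y‖ := by
  have h : γ x - γ y = (γ (x - y) - 1) * γ y := by
    rw [sub_mul, one_mul, ← AddChar.map_add_eq_mul, sub_add_cancel]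
  rw [h, norm_mul, AddChar.norm_apply, mul_one]

lemma bohr_zero_mem (Γ : Finset (AddChar G ℂ)) {ρ : ℝ} (h : 0 ≤ ρ) : (0 : G) ∈ bohr Γ ρ := by
  simp [mem_bohr, h]

lemma bohr_sub_mem {Γ : Finset (AddChar G ℂ)} {ρ σ : ℝ} {x y : G} (hx : x ∈ bohr Γ ρ)
    (hy : y ∈ bohr Γ σ) : x - y ∈ bohr Γ (ρ + σ) := by
  rw [mem_bohr] at *
  intro γ hγ
  rw [norm_char_sub]
  have : γ x - γ y = (γ x - 1) - (γ y - 1) := by ring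
  rw [this]
  exact (norm_sub_le _ _).trans (add_le_add (hx γ hγ) (hy γ hγ))

lemma bohr_neg_mem {Γ : Finset (AddChar G ℂ)} {ρ : ℝ} {x : G} (hx : x ∈ bohr Γ ρ) :
    -x ∈ bohr Γ ρ := by
  rw [mem_bohr] at *
  intro γ hγ
  have := norm_char_sub γ 0 x
  rw [zero_sub, AddChar.map_zero_eq_one] at this
  rw [this, norm_sub_rev]
  exact hx γ hγ

lemma bohr_add_mem {Γ : Finset (AddChar G ℂ)} {ρ σ : ℝ} {x y : G} (hx : x ∈ bohr Γ ρ)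
    (hy : y ∈ bohr Γ σ) : x + y ∈ bohr Γ (ρ + σ) := by
  have := bohr_sub_mem hx (bohr_neg_mem hy)
  rwa [sub_neg_eq_add] at this

lemma bohr_mono {Γ : Finset (AddChar G ℂ)} {ρ σ : ℝ} (h : ρ ≤ σ) : bohr Γ ρ ⊆ bohr Γ σ := by
  intro x hx
  rw [mem_bohr] at *
  exact fun γ hγ => (hx γ hγ).trans h

lemma bohr_anti {Γ Γ' : Finset (AddChar G ℂ)} {ρ : ℝ} (h : Γ ⊆ Γ') : bohr Γ' ρ ⊆ bohr Γ ρ := by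
  intro x hx
  rw [mem_bohr] at *
  exact fun γ hγ => hx γ (h hγ)

lemma bohr_card_pos (Γ : Finset (AddChar G ℂ)) {ρ : ℝ} (h : 0 ≤ ρ) : 0 < (bohr Γ ρ).card :=
  Finset.card_pos.2 ⟨0, bohr_zero_mem Γ h⟩

lemma bohr_two (Γ : Finset (AddChar G ℂ)) : bohr Γ 2 = Finset.univ := by
  ext x
  simp only [mem_bohr, Finset.mem_univ, iff_true]
  intro γ _
  calc ‖γ x - 1‖ ≤ ‖γ x‖ + ‖(1 : ℂ)‖ := norm_sub_le _ _
    _ = 2 := by rw [AddChar.norm_apply]; norm_num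

lemma floor_cell {a ρ : ℝ} (hρ : 0 < ρ) (ha : |a| ≤ 2 * ρ) : ⌊a / (ρ / 2)⌋ ∈ Finset.Icc (-4 : ℤ) 4 := by
  rw [abs_le] at ha
  rw [Finset.mem_Icc]
  constructor
  · rw [Int.le_floor]; rw [le_div_iff₀ (by positivity)]; push_cast; linarith
  · have : ⌊a / (ρ / 2)⌋ ≤ ⌊(4:ℝ)⌋ := Int.floor_le_floor (by rw [div_le_iff₀ (by positivity)]; linarith)
    simpa using this

lemma floor_close {a b ρ : ℝ} (hρ : 0 < ρ) (h : ⌊a / (ρ / 2)⌋ = ⌊b / (ρ / 2)⌋) : |a - b| ≤ ρ / 2 := by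
  have := Int.abs_sub_lt_one_of_floor_eq_floor h
  rw [← sub_div, abs_div, abs_of_pos (by positivity : 0 < ρ / 2), div_lt_one (by positivity)] at this
  exact this.le

lemma bohr_double (Γ : Finset (AddChar G ℂ)) {ρ : ℝ} (hρ : 0 < ρ) :
    (bohr Γ (2 * ρ)).card ≤ 81 ^ Γ.card * (bohr Γ ρ).card := by
  set f : G → (Γ → ℤ × ℤ) := fun x γ =>
    (⌊((γ.1 x) - 1).re / (ρ / 2)⌋, ⌊((γ.1 x) - 1).im / (ρ / 2)⌋) with hf
  have himg : (Finset.image f (bohr Γ (2 * ρ))).card ≤ 81 ^ Γ.card := by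
    have hsub : Finset.image f (bohr Γ (2 * ρ)) ⊆
        Fintype.piFinset (fun _ : Γ => (Finset.Icc (-4 : ℤ) 4) ×ˢ (Finset.Icc (-4 : ℤ) 4)) := by
      intro y hy
      obtain ⟨x, hx, rfl⟩ := Finset.mem_image.1 hy
      rw [Fintype.mem_piFinset]
      intro γ
      have h1 := mem_bohr.1 hx γ.1 γ.2
      rw [Finset.mem_product]
      exact ⟨floor_cell hρ ((Complex.abs_re_le_norm _).trans h1),
        floor_cell hρ ((Complex.abs_im_le_norm _).trans h1)⟩
    refine (Finset.card_le_card hsub).trans ?_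
    simp
  have h := Finset.card_le_mul_card_image (f := f) (bohr Γ (2 * ρ)) (bohr Γ ρ).card ?_
  · calc _ ≤ _ := h
      _ ≤ (bohr Γ ρ).card * 81 ^ Γ.card := Nat.mul_le_mul_left _ himg
      _ = _ := mul_comm _ _
  · intro b hb
    obtain ⟨x0, hx0, rfl⟩ := Finset.mem_image.1 hb
    refine Finset.card_le_card_of_injOn (fun x => x - x0) ?_ ?_
    · intro x hx
      have hx' := (Finset.mem_filter.1 hx).2
      simp only [Finset.mem_coe]
      rw [mem_bohr]
      intro γ hγ
      rw [norm_char_sub]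
      have h2 := congrFun hx' ⟨γ, hγ⟩
      simp only [hf, Prod.mk.injEq] at h2
      have h3 := floor_close hρ h2.1
      have h4 := floor_close hρ h2.2
      have : γ x - γ x0 = (γ x - 1) - (γ x0 - 1) := by ring
      rw [this]
      refine (Complex.norm_le_abs_re_add_abs_im _).trans ?_
      rw [Complex.sub_re (γ x - 1), Complex.sub_im (γ x - 1)]
      linarith
    · intro a _ b _ h
      exact sub_left_injective h

lemma bohr_size (Γ : Finset (AddChar G ℂ)) (s : ℕ) :
    Fintype.card G ≤ 81 ^ (Γ.card * s) * (bohr Γ (2 * (1 / 2) ^ s)).card := by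
  induction s with
  | zero => simp [bohr_two]
  | succ s ih =>
    have h := bohr_double Γ (ρ := 2 * (1 / 2) ^ (s + 1)) (by positivity)
    have e : (2 : ℝ) * (2 * (1 / 2) ^ (s + 1)) = 2 * (1 / 2) ^ s := by rw [pow_succ]; ring
    rw [e] at h
    calc _ ≤ _ := ih
      _ ≤ 81 ^ (Γ.card * s) * (81 ^ Γ.card * (bohr Γ (2 * (1 / 2) ^ (s + 1))).card) :=
        Nat.mul_le_mul_left _ h
      _ = _ := by rw [← mul_assoc, ← pow_add]; rfl

lemma bohr_regular (Γ : Finset (AddChar G ℂ)) {ρ η : ℝ} (hρ : 0 < ρ) (hη : 0 < η) (hη1 : η ≤ 1)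
    {n : ℕ} (hn : 10 * (Γ.card : ℝ) < n * η) :
    ∃ ρ', ρ / 2 ≤ ρ' ∧ ρ' ≤ ρ ∧
      ((bohr Γ (ρ' + ρ / (2 * n))).card : ℝ) ≤ (1 + η) * (bohr Γ ρ').card := by
  by_contra hcon
  push Not at hcon
  have hn0 : (0 : ℝ) < n := by
    have : 0 < (n : ℝ) * η := lt_of_le_of_lt (by positivity) hn
    exact pos_of_mul_pos_left this hη.le
  have key : ∀ i : ℕ, i ≤ n → (1 + η) ^ i * (bohr Γ (ρ / 2)).card ≤
      ((bohr Γ (ρ / 2 + i * (ρ / (2 * n)))).card : ℝ) := by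
    intro i
    induction i with
    | zero => intro _; simp
    | succ i ih =>
      intro hi
      have h1 := ih (by omega)
      have hi' : (i : ℝ) + 1 ≤ n := by exact_mod_cast hi
      have h2 := hcon (ρ / 2 + i * (ρ / (2 * n))) (by
        have : 0 ≤ i * (ρ / (2 * n)) := by positivity
        linarith) (by
        have : (i : ℝ) * (ρ / (2 * n)) ≤ n * (ρ / (2 * n)) :=
          mul_le_mul_of_nonneg_right (by linarith) (by positivity)
        have e : n * (ρ / (2 * n)) = ρ / 2 := by field_simp
        linarith)
      have e : ρ / 2 + ((i + 1 : ℕ) : ℝ) * (ρ / (2 * n)) = ρ / 2 + i * (ρ / (2 * n)) + ρ / (2 * n) := by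
        push_cast; ring
      rw [e, pow_succ]
      calc (1 + η) ^ i * (1 + η) * ((bohr Γ (ρ / 2)).card : ℝ)
          = (1 + η) * ((1 + η) ^ i * ((bohr Γ (ρ / 2)).card : ℝ)) := by ring
        _ ≤ _ := (mul_le_mul_of_nonneg_left h1 (by linarith)).trans h2.le
  have h := key n le_rfl
  have e : ρ / 2 + n * (ρ / (2 * n)) = 2 * (ρ / 2) := by field_simp; ring
  rw [e] at h
  have h2 : ((bohr Γ (2 * (ρ / 2))).card : ℝ) ≤ 81 ^ Γ.card * (bohr Γ (ρ / 2)).card := by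
    exact_mod_cast bohr_double Γ (ρ := ρ / 2) (by positivity)
  have hpos : (0 : ℝ) < (bohr Γ (ρ / 2)).card := by
    exact_mod_cast bohr_card_pos Γ (by positivity)
  have h3 : (1 + η) ^ n ≤ (81 : ℝ) ^ Γ.card := le_of_mul_le_mul_right (h.trans h2) hpos
  have h4 : Real.exp (η / 2) ≤ 1 + η := by
    have := Real.abs_exp_sub_one_sub_id_le (x := η / 2) (by rw [abs_of_pos] <;> linarith)
    have := (abs_le.1 this).2
    nlinarith
  have h5 : Real.exp (5 * Γ.card) < (1 + η) ^ n := by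
    calc Real.exp (5 * Γ.card) < Real.exp (n * (η / 2)) := Real.exp_lt_exp.2 (by linarith)
      _ = Real.exp (η / 2) ^ n := by rw [Real.exp_nat_mul]
      _ ≤ _ := pow_le_pow_left₀ (Real.exp_pos _).le h4 n
  have h6 : (81 : ℝ) ^ Γ.card ≤ Real.exp (5 * Γ.card) := by
    rw [mul_comm, Real.exp_nat_mul]
    refine pow_le_pow_left₀ (by norm_num) ?_ _
    have : (2.7 : ℝ) ≤ Real.exp 1 := by have := Real.exp_one_gt_d9; linarith
    calc (81 : ℝ) ≤ 2.7 ^ 5 := by norm_num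
      _ ≤ Real.exp 1 ^ 5 := pow_le_pow_left₀ (by norm_num) this 5
      _ = Real.exp 5 := by rw [← Real.exp_nat_mul]; norm_num
  linarith

/-- shift loss for near-invariant sets -/
lemma shift_loss {B C : Finset G} {η : ℝ} (hBC : B ⊆ C) (hC : (C.card : ℝ) ≤ (1 + η) * B.card) (t : G)
    (ht : ∀ x ∈ B, x + t ∈ C) : ((B.filter (fun x => x - t ∉ B)).card : ℝ) ≤ η * B.card := by
  have h1 : (B.filter (fun x => x - t ∉ B)) ∪ B.image (fun x => x + t) ⊆ C := by
    intro x hx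
    rcases Finset.mem_union.1 hx with h | h
    · exact hBC (Finset.mem_filter.1 h).1
    · obtain ⟨y, hy, rfl⟩ := Finset.mem_image.1 h
      exact ht y hy
  have h2 : Disjoint (B.filter (fun x => x - t ∉ B)) (B.image (fun x => x + t)) := by
    rw [Finset.disjoint_left]
    intro x hx hx2
    obtain ⟨y, hy, rfl⟩ := Finset.mem_image.1 hx2
    have := (Finset.mem_filter.1 hx).2
    simp [hy] at this
  have h3 := Finset.card_le_card h1
  rw [Finset.card_union_of_disjoint h2, Finset.card_image_of_injective _ (add_left_injective t)] at h3
  have h4 : ((B.filter (fun x => x - t ∉ B)).card : ℝ) + B.card ≤ C.card := by exact_mod_cast h3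
  linarith

end bohr


section part1
variable {G : Type*} [AddCommGroup G] [Fintype G]

/-- correlation -/
noncomputable def cor (f g : G → ℝ) (t : G) : ℝ := ∑ x, f x * g (x + t)

/-- convolution -/
noncomputable def cnv (f g : G → ℝ) (t : G) : ℝ := ∑ x, f x * g (t - x)

lemma cor_sub (f g : G → ℝ) (u v : G) : cor f g (u - v) = ∑ s, f (s + v) * g (s + u) := by
  unfold cor
  rw [← Equiv.sum_comp (Equiv.addRight v)]
  refine Finset.sum_congr rfl fun s _ => ?_
  simp only [Equiv.coe_addRight]
  congr 2; abel

lemma cnv_sub (f g : G → ℝ) (u v : G) : cnv f g (u - v) = ∑ s, f (s + u) * g (-s - v) := by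
  unfold cnv
  rw [← Equiv.sum_comp (Equiv.addRight u)]
  refine Finset.sum_congr rfl fun s _ => ?_
  simp only [Equiv.coe_addRight]
  congr 2; abel

lemma sum3_comm {α β γ : Type*} (s : Finset α) (t : Finset β) (r : Finset γ) (F : α → β → γ → ℝ) :
    ∑ u ∈ s, ∑ v ∈ t, ∑ w ∈ r, F u v w = ∑ w ∈ r, ∑ u ∈ s, ∑ v ∈ t, F u v w := by
  rw [Finset.sum_comm]
  calc _ = ∑ v ∈ t, ∑ w ∈ r, ∑ u ∈ s, F u v w :=
        Finset.sum_congr rfl fun v _ => Finset.sum_comm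
    _ = ∑ w ∈ r, ∑ v ∈ t, ∑ u ∈ s, F u v w := Finset.sum_comm
    _ = _ := Finset.sum_congr rfl fun v _ => Finset.sum_comm

lemma moment_eq (f : G → ℝ) (E : Finset G) (k : ℕ) :
    ∑ u ∈ E, ∑ v ∈ E, cor f f (u - v) ^ k =
      ∑ s : Fin k → G, (∑ u ∈ E, ∏ i, f (s i + u)) ^ 2 := by
  simp_rw [cor_sub, Fintype.sum_pow, Finset.prod_mul_distrib]
  rw [sum3_comm]
  refine Finset.sum_congr rfl fun s _ => ?_
  rw [pow_two, Finset.sum_mul_sum, Finset.sum_comm]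

lemma moment_nonneg (f : G → ℝ) (E : Finset G) (k : ℕ) :
    0 ≤ ∑ u ∈ E, ∑ v ∈ E, cor f f (u - v) ^ k := by
  rw [moment_eq]; positivity

lemma cnv_moment_le (f : G → ℝ) (E : Finset G) (hE : ∀ x ∈ E, -x ∈ E) (k : ℕ) :
    ∑ u ∈ E, ∑ v ∈ E, cnv f f (u - v) ^ k ≤ ∑ u ∈ E, ∑ v ∈ E, cor f f (u - v) ^ k := by
  rw [moment_eq]
  have h1 : ∑ u ∈ E, ∑ v ∈ E, cnv f f (u - v) ^ k =
      ∑ s : Fin k → G, (∑ u ∈ E, ∏ i, f (s i + u)) * (∑ u ∈ E, ∏ i, f ((-s) i + u)) := by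
    simp_rw [cnv_sub, Fintype.sum_pow, Finset.prod_mul_distrib]
    rw [sum3_comm]
    refine Finset.sum_congr rfl fun s _ => ?_
    rw [Finset.sum_mul_sum]
    refine Finset.sum_congr rfl fun u _ => ?_
    refine Finset.sum_nbij' (fun v => -v) (fun v => -v) hE hE (by simp) (by simp) ?_
    intro v _
    simp [sub_eq_add_neg]
  rw [h1]
  set P : (Fin k → G) → ℝ := fun s => ∑ u ∈ E, ∏ i, f (s i + u) with hP
  have h2 : ∑ s, P (-s) ^ 2 = ∑ s, P s ^ 2 :=
    Equiv.sum_comp (Equiv.neg (Fin k → G)) (fun s => P s ^ 2)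
  calc ∑ s, P s * P (-s) ≤ ∑ s, (P s ^ 2 / 2 + P (-s) ^ 2 / 2) :=
        Finset.sum_le_sum fun s _ => by nlinarith [sq_nonneg (P s - P (-s))]
    _ = _ := by rw [Finset.sum_add_distrib, ← Finset.sum_div, ← Finset.sum_div, h2]; ring

lemma choose_bound {p : ℕ} (hp : 0 < p) : (15 : ℝ) ^ p ≤ ((16 * p).choose p : ℝ) := by
  have h := Nat.pow_le_choose (α := ℝ) p (16 * p)
  refine le_trans ?_ h
  rw [le_div_iff₀ (by exact_mod_cast Nat.factorial_pos p)]
  have h1 : (p.factorial : ℝ) ≤ (p : ℝ) ^ p := by exact_mod_cast Nat.factorial_le_pow p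
  have h2 : ((16 * p + 1 - p : ℕ) : ℝ) = 15 * p + 1 := by
    rw [show 16 * p + 1 - p = 15 * p + 1 by omega]; push_cast; ring
  calc (15 : ℝ) ^ p * p.factorial ≤ 15 ^ p * (p : ℝ) ^ p := by gcongr
    _ = (15 * p : ℝ) ^ p := by rw [mul_pow]
    _ ≤ _ := by rw [h2]; gcongr; linarith

/-- unbalancing -/
lemma unbalance (f : G → ℝ) (E : Finset G) {b : ℝ} (hb : 0 < b) {p : ℕ} (hp : 0 < p)
    (h : (3 / 16 * b) ^ p * (E.card : ℝ) ^ 2 ≤ ∑ u ∈ E, ∑ v ∈ E, cor f f (u - v) ^ p) :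
    (45 / 16 : ℝ) ^ p * b ^ (16 * p) * (E.card : ℝ) ^ 2 ≤
      ∑ u ∈ E, ∑ v ∈ E, (cor f f (u - v) + b) ^ (16 * p) := by
  have h1 : ∑ u ∈ E, ∑ v ∈ E, (cor f f (u - v) + b) ^ (16 * p) =
      ∑ k ∈ Finset.range (16 * p + 1), (∑ u ∈ E, ∑ v ∈ E, cor f f (u - v) ^ k) *
        (b ^ (16 * p - k) * ((16 * p).choose k : ℝ)) := by
    simp_rw [add_pow]
    rw [sum3_comm]
    refine Finset.sum_congr rfl fun k _ => ?_
    rw [Finset.sum_mul]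
    refine Finset.sum_congr rfl fun u _ => ?_
    rw [Finset.sum_mul]
    refine Finset.sum_congr rfl fun v _ => ?_
    ring
  rw [h1]
  have h2 := Finset.single_le_sum (f := fun k => (∑ u ∈ E, ∑ v ∈ E, cor f f (u - v) ^ k) *
        (b ^ (16 * p - k) * ((16 * p).choose k : ℝ))) (s := Finset.range (16 * p + 1)) (a := p)
        (fun k _ => mul_nonneg (moment_nonneg f E k) (by positivity))
        (Finset.mem_range.2 (by omega))
  refine le_trans ?_ h2
  calc (45 / 16 : ℝ) ^ p * b ^ (16 * p) * (E.card : ℝ) ^ 2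
      = ((3 / 16 * b) ^ p * (E.card : ℝ) ^ 2) * (b ^ (16 * p - p) * 15 ^ p) := by
        have : b ^ (16 * p) = b ^ p * b ^ (16 * p - p) := by rw [← pow_add]; congr 1; omega
        rw [this, mul_pow, show (45 / 16 : ℝ) = 3 / 16 * 15 by norm_num, mul_pow]; ring
    _ ≤ _ := by
      refine mul_le_mul h ?_ (by positivity) (moment_nonneg f E p)
      exact mul_le_mul_of_nonneg_left (choose_bound hp) (by positivity)

lemma cor_bounds {A B : Finset G} (hAB : A ⊆ B) {η : ℝ} {t : G}
    (h : ((B.filter (fun x => x - t ∉ B)).card : ℝ) ≤ η * B.card) :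
    (A.card : ℝ) - η * B.card ≤ cor (ind A) (ind B) (-t) ∧ cor (ind A) (ind B) (-t) ≤ A.card := by
  have e : cor (ind A) (ind B) (-t) = ∑ x ∈ A, ind B (x - t) := by
    unfold cor
    rw [sum_ind_mul]; simp [sub_eq_add_neg]
  rw [e]
  constructor
  · have h1 : (A.card : ℝ) - ∑ x ∈ A, ind B (x - t) = ((A.filter (fun x => x - t ∉ B)).card : ℝ) := by
      rw [Finset.card_filter]
      push_cast
      rw [Finset.card_eq_sum_ones]
      push_cast
      rw [← Finset.sum_sub_distrib]
      refine Finset.sum_congr rfl fun x _ => ?_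
      unfold ind
      split_ifs <;> simp_all
    have h2 : ((A.filter (fun x => x - t ∉ B)).card : ℝ) ≤ (B.filter (fun x => x - t ∉ B)).card := by
      exact_mod_cast Finset.card_le_card (Finset.filter_subset_filter _ hAB)
    linarith
  · calc _ ≤ ∑ x ∈ A, (1 : ℝ) := Finset.sum_le_sum fun x _ => ind_le_one _ _
      _ = _ := by simp

lemma cor_neg (f g : G → ℝ) (t : G) : cor f g (-t) = cor g f t := by
  unfold cor
  rw [← Equiv.sum_comp (Equiv.addRight t)]
  refine Finset.sum_congr rfl fun s _ => ?_
  simp [mul_comm]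

lemma cnv_eq_cor (f : G → ℝ) {B : Finset G} (hB : ∀ x ∈ B, -x ∈ B) (t : G) :
    cnv f (ind B) t = cor f (ind B) (-t) := by
  unfold cnv cor
  refine Finset.sum_congr rfl fun s _ => ?_
  congr 1
  have : (t - s ∈ B) ↔ (s + -t ∈ B) := by
    constructor
    · intro h; have := hB _ h; rwa [neg_sub, sub_eq_add_neg] at this
    · intro h; have := hB _ h; rwa [neg_add_rev, neg_neg, ← sub_eq_add_neg] at this
  unfold ind
  simp [this]

lemma cnv_comm (f g : G → ℝ) (t : G) : cnv f g t = cnv g f t := by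
  unfold cnv
  rw [← Equiv.sum_comp (Equiv.subLeft t)]
  refine Finset.sum_congr rfl fun s _ => ?_
  simp [mul_comm]

lemma cnv_expand (f g : G → ℝ) (c : ℝ) (t : G) :
    cnv (fun x => c * f x - g x) (fun x => c * f x - g x) t =
      c ^ 2 * cnv f f t - c * cnv f g t - c * cnv g f t + cnv g g t := by
  unfold cnv
  simp only [Finset.mul_sum, ← Finset.sum_sub_distrib, ← Finset.sum_add_distrib]
  exact Finset.sum_congr rfl fun s _ => by ring

lemma cor_expand (f g : G → ℝ) (c : ℝ) (t : G) :
    cor (fun x => c * f x - g x) (fun x => c * f x - g x) t =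
      c ^ 2 * cor f f t - c * cor f g t - c * cor g f t + cor g g t := by
  unfold cor
  simp only [Finset.mul_sum, ← Finset.sum_sub_distrib, ← Finset.sum_add_distrib]
  exact Finset.sum_congr rfl fun s _ => by ring

lemma part1_a {A B E : Finset G} {w : G → ℝ} {a η : ℝ} {p : ℕ} (hAB : A ⊆ B)
    (hB : ∀ x ∈ B, -x ∈ B) (hE0 : E.Nonempty)
    (ha : 0 < a) (hA : (A.card : ℝ) = a * B.card) (hB0 : 0 < B.card)
    (hinv : ∀ u ∈ E, ∀ v ∈ E, ((B.filter (fun x => x - (u - v) ∉ B)).card : ℝ) ≤ η * B.card)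
    (hη : η ≤ a / 256) (hw : ∀ t, w t = 0 ∨ w t = 1)
    (hp : Even p) (hp0 : 0 < p)
    (hcount : ∑ u ∈ E, ∑ v ∈ E, w (u - v) * cnv (ind A) (ind A) (u - v) ≤
      1 / 2 * a ^ 2 * B.card * ∑ u ∈ E, ∑ v ∈ E, w (u - v))
    (hws : (1 / 2 : ℝ) ^ p * (E.card : ℝ) ^ 2 ≤ ∑ u ∈ E, ∑ v ∈ E, w (u - v)) :
    (3 / 16 * (B.card : ℝ)) ^ p * (E.card : ℝ) ^ 2 ≤ ∑ u ∈ E, ∑ v ∈ E,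
      cnv (fun x => a⁻¹ * ind A x - ind B x) (fun x => a⁻¹ * ind A x - ind B x) (u - v) ^ p := by
  set F : G → ℝ := cnv (fun x => a⁻¹ * ind A x - ind B x) (fun x => a⁻¹ * ind A x - ind B x) with hF
  have hw0 : ∀ t, 0 ≤ w t := fun t => by rcases hw t with h | h <;> rw [h]; norm_num
  set b : ℝ := (B.card : ℝ) with hb
  have hb0 : 0 < b := by rw [hb]; exact_mod_cast hB0
  -- pointwise bound
  have hpt : ∀ u ∈ E, ∀ v ∈ E, F (u - v) ≤ a⁻¹ ^ 2 * cnv (ind A) (ind A) (u - v) - 7 / 8 * b := by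
    intro u hu v hv
    have h1 := cor_bounds hAB (hinv u hu v hv)
    have h2 := cor_bounds (subset_refl B) (hinv u hu v hv)
    rw [hF, cnv_expand, cnv_comm (ind B) (ind A), cnv_eq_cor _ hB, cnv_eq_cor _ hB]
    have h3 : a⁻¹ * cor (ind A) (ind B) (-(u - v)) ≥ b * (1 - 1 / 256) := by
      calc a⁻¹ * cor (ind A) (ind B) (-(u - v)) ≥ a⁻¹ * (a * b - a / 256 * b) := by
            refine mul_le_mul_of_nonneg_left ?_ (by positivity)
            have : η * b ≤ a / 256 * b := mul_le_mul_of_nonneg_right hη hb0.le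
            linarith [h1.1]
        _ = _ := by field_simp
    linarith [h2.2]
  set W : ℝ := ∑ u ∈ E, ∑ v ∈ E, w (u - v) with hW
  have hE : (0 : ℝ) < E.card := by exact_mod_cast Finset.card_pos.2 hE0
  have hWpos : 0 < W := lt_of_lt_of_le (by positivity) hws
  -- averaged bound
  have havg : 3 / 8 * b * W ≤ ∑ u ∈ E, ∑ v ∈ E, w (u - v) * |F (u - v)| := by
    have h1 : ∑ u ∈ E, ∑ v ∈ E, w (u - v) * |F (u - v)| ≥
        ∑ u ∈ E, ∑ v ∈ E, (7 / 8 * b * w (u - v) -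
          a⁻¹ ^ 2 * (w (u - v) * cnv (ind A) (ind A) (u - v))) := by
      refine Finset.sum_le_sum fun u hu => Finset.sum_le_sum fun v hv => ?_
      have h2 := mul_le_mul_of_nonneg_left (hpt u hu v hv) (hw0 (u - v))
      have h3 := mul_le_mul_of_nonneg_left (neg_abs_le (F (u - v))) (hw0 (u - v))
      nlinarith
    simp only [Finset.sum_sub_distrib, ← Finset.mul_sum] at h1
    have h2 : a⁻¹ ^ 2 * ∑ u ∈ E, ∑ v ∈ E, w (u - v) * cnv (ind A) (ind A) (u - v) ≤ 1 / 2 * b * W := by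
      calc _ ≤ a⁻¹ ^ 2 * (1 / 2 * a ^ 2 * b * W) := mul_le_mul_of_nonneg_left hcount (by positivity)
        _ = _ := by field_simp
    rw [← hW] at h1
    linarith
  -- power mean
  have hpm : (3 / 8 * b) ^ p * W ≤ ∑ u ∈ E, ∑ v ∈ E, w (u - v) * |F (u - v)| ^ p := by
    set c : ℝ := 3 / 8 * b with hc
    have hc0 : 0 < c := by positivity
    have h1 : ∀ y : ℝ, 0 ≤ y → c ^ p * (1 - p) + c ^ p * p / c * y ≤ y ^ p := by
      intro y hy
      have h2 := one_add_mul_le_pow (a := y / c - 1) (by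
        have : 0 ≤ y / c := by positivity
        linarith) p
      have h3 := mul_le_mul_of_nonneg_left h2 (by positivity : 0 ≤ c ^ p)
      rw [← mul_pow, show c * (1 + (y / c - 1)) = y by field_simp; ring] at h3
      calc _ = c ^ p * (1 + p * (y / c - 1)) := by ring
        _ ≤ _ := h3
    calc c ^ p * W = c ^ p * (1 - p) * W + c ^ p * p / c * (c * W) := by field_simp; ring
      _ ≤ c ^ p * (1 - p) * W + c ^ p * p / c * ∑ u ∈ E, ∑ v ∈ E, w (u - v) * |F (u - v)| := by
        have := mul_le_mul_of_nonneg_left havg (by positivity : 0 ≤ c ^ p * p / c)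
        linarith
      _ = ∑ u ∈ E, ∑ v ∈ E, w (u - v) * (c ^ p * (1 - p) + c ^ p * p / c * |F (u - v)|) := by
        rw [hW, Finset.mul_sum, Finset.mul_sum, ← Finset.sum_add_distrib]
        refine Finset.sum_congr rfl fun u _ => ?_
        rw [Finset.mul_sum, Finset.mul_sum, ← Finset.sum_add_distrib]
        exact Finset.sum_congr rfl fun v _ => by ring
      _ ≤ _ := Finset.sum_le_sum fun u hu => Finset.sum_le_sum fun v hv =>
        mul_le_mul_of_nonneg_left (h1 _ (abs_nonneg _)) (hw0 _)
  calc (3 / 16 * b) ^ p * (E.card : ℝ) ^ 2 = (3 / 8 * b) ^ p * ((1 / 2 : ℝ) ^ p * (E.card : ℝ) ^ 2) := by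
        rw [← mul_assoc, ← mul_pow]; congr 2; ring
    _ ≤ (3 / 8 * b) ^ p * W := mul_le_mul_of_nonneg_left hws (by positivity)
    _ ≤ _ := hpm
    _ ≤ _ := by
      refine Finset.sum_le_sum fun u hu => Finset.sum_le_sum fun v hv => ?_
      rw [hp.pow_abs]
      rcases hw (u - v) with h | h <;> rw [h]
      · rw [zero_mul]; exact hp.pow_nonneg _
      · rw [one_mul]

lemma part1 {A B E : Finset G} {w : G → ℝ} {a η : ℝ} {p : ℕ} (hAB : A ⊆ B)
    (hB : ∀ x ∈ B, -x ∈ B) (hE0 : E.Nonempty) (hE : ∀ x ∈ E, -x ∈ E)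
    (ha : 0 < a) (ha1 : a ≤ 1) (hA : (A.card : ℝ) = a * B.card) (hB0 : 0 < B.card)
    (hinv : ∀ u ∈ E, ∀ v ∈ E, ((B.filter (fun x => x - (u - v) ∉ B)).card : ℝ) ≤ η * B.card)
    (hη : η ≤ a / 256) (hw : ∀ t, w t = 0 ∨ w t = 1)
    (hp : Even p) (hp0 : 16 ≤ p)
    (hcount : ∑ u ∈ E, ∑ v ∈ E, w (u - v) * cnv (ind A) (ind A) (u - v) ≤
      1 / 2 * a ^ 2 * B.card * ∑ u ∈ E, ∑ v ∈ E, w (u - v))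
    (hws : (1 / 2 : ℝ) ^ p * (E.card : ℝ) ^ 2 ≤ ∑ u ∈ E, ∑ v ∈ E, w (u - v)) :
    (2 : ℝ) ^ p * (a ^ 2 * B.card) ^ (16 * p) * (E.card : ℝ) ^ 2 ≤
      ∑ u ∈ E, ∑ v ∈ E, cor (ind A) (ind A) (u - v) ^ (16 * p) := by
  have h0 := part1_a hAB hB hE0 ha hA hB0 hinv hη hw hp (by omega) hcount hws
  have h1 := unbalance _ E (by exact_mod_cast hB0 : (0 : ℝ) < B.card) (by omega)
    (h0.trans (cnv_moment_le _ E hE p))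
  set b : ℝ := (B.card : ℝ) with hb
  have hb0 : 0 < b := by rw [hb]; exact_mod_cast hB0
  have hη0 : 0 ≤ η := by
    obtain ⟨u, hu⟩ := hE0
    have := hinv u hu u hu
    have h2 : 0 ≤ η * b := le_trans (by positivity) this
    exact nonneg_of_mul_nonneg_left h2 hb0
  have hR0 : ∀ t, 0 ≤ cor (ind A) (ind A) t := fun t =>
    Finset.sum_nonneg fun x _ => mul_nonneg (ind_nonneg _ _) (ind_nonneg _ _)
  have hpt : ∀ u ∈ E, ∀ v ∈ E, (cor (fun x => a⁻¹ * ind A x - ind B x)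
      (fun x => a⁻¹ * ind A x - ind B x) (u - v) + b) ^ (16 * p) ≤
      b ^ (16 * p) + Real.exp (p / 4) * (a⁻¹ ^ 2 * cor (ind A) (ind A) (u - v)) ^ (16 * p) := by
    intro u hu v hv
    have i1 := cor_bounds hAB (hinv u hu v hv)
    have i2 := cor_bounds hAB (hinv v hv u hu)
    have i3 := cor_bounds (subset_refl B) (hinv v hv u hu)
    rw [neg_sub] at i1 i2 i3
    rw [← neg_sub u v, cor_neg] at i1
    rw [cor_expand]
    set R := cor (ind A) (ind A) (u - v) with hR
    set X := a⁻¹ ^ 2 * R with hX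
    have hX0 : 0 ≤ X := mul_nonneg (by positivity) (hR0 _)
    have j : ∀ y : ℝ, a * b - η * b ≤ y → y ≤ a * b → b * (1 - 1 / 256) ≤ a⁻¹ * y ∧ a⁻¹ * y ≤ b := by
      intro y hy1 hy2
      constructor
      · calc b * (1 - 1 / 256) = a⁻¹ * (a * b - a / 256 * b) := by field_simp
          _ ≤ _ := by
            refine mul_le_mul_of_nonneg_left ?_ (by positivity)
            have : η * b ≤ a / 256 * b := mul_le_mul_of_nonneg_right hη hb0.le
            linarith
      · calc a⁻¹ * y ≤ a⁻¹ * (a * b) := mul_le_mul_of_nonneg_left hy2 (by positivity)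
          _ = b := by field_simp
    rw [hA] at i1 i2
    have j1 := j _ i1.1 i1.2
    have j2 := j _ i2.1 i2.2
    have j3 : b - η * b ≤ cor (ind B) (ind B) (u - v) := i3.1
    have j4 : cor (ind B) (ind B) (u - v) ≤ b := i3.2
    have hηb : η * b ≤ 1 / 256 * b := mul_le_mul_of_nonneg_right (by linarith) hb0.le
    set Z := X - a⁻¹ * cor (ind A) (ind B) (u - v) - a⁻¹ * cor (ind B) (ind A) (u - v) +
        cor (ind B) (ind B) (u - v) + b with hZ
    have k1 : |Z| ≤ X + b / 128 := by
      rw [abs_le]; constructor <;> linarith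
    have hev : Even (16 * p) := by rw [Nat.even_mul]; left; decide
    rw [← hev.pow_abs]
    by_cases hXb : X ≤ b / 2
    · have : |Z| ^ (16 * p) ≤ b ^ (16 * p) := pow_le_pow_left₀ (abs_nonneg _) (by linarith) _
      have : 0 ≤ Real.exp (p / 4) * X ^ (16 * p) := by positivity
      linarith
    · push Not at hXb
      have k2 : |Z| ≤ Real.exp (1 / 64) * X := by
        have : (1 : ℝ) / 64 + 1 ≤ Real.exp (1 / 64) := Real.add_one_le_exp _
        have := mul_le_mul_of_nonneg_right this hX0
        linarith
      have : |Z| ^ (16 * p) ≤ (Real.exp (1 / 64) * X) ^ (16 * p) := pow_le_pow_left₀ (abs_nonneg _) k2 _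
      rw [mul_pow, ← Real.exp_nat_mul] at this
      have e : ((16 * p : ℕ) : ℝ) * (1 / 64) = p / 4 := by push_cast; ring
      rw [e] at this
      have : 0 ≤ b ^ (16 * p) := by positivity
      linarith
  have h2 := h1.trans (Finset.sum_le_sum fun u hu => Finset.sum_le_sum fun v hv => hpt u hu v hv)
  simp only [Finset.sum_add_distrib, ← Finset.mul_sum, Finset.sum_const, mul_pow, nsmul_eq_mul] at h2
  set M := ∑ u ∈ E, ∑ v ∈ E, cor (ind A) (ind A) (u - v) ^ (16 * p) with hM
  set n : ℝ := (E.card : ℝ) with hn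
  have hn0 : 0 < n := by rw [hn]; exact_mod_cast Finset.card_pos.2 hE0
  have key : Real.exp (p / 4) * 2 ^ p ≤ (45 / 16 : ℝ) ^ p - 1 := by
    have e1 : Real.exp (p / 4) ≤ (1.3 : ℝ) ^ p := by
      rw [show (p : ℝ) / 4 = p * (1 / 4) by ring, Real.exp_nat_mul]
      refine pow_le_pow_left₀ (Real.exp_pos _).le ?_ _
      have h4 : Real.exp (1 / 4) ^ 4 ≤ (1.3 : ℝ) ^ 4 := by
        rw [← Real.exp_nat_mul]; norm_num
        have := Real.exp_one_lt_d9; linarith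
      exact le_of_pow_le_pow_left₀ (by norm_num) (by norm_num) h4
    have e2 : (2.6 : ℝ) ^ p + 1 ≤ (45 / 16 : ℝ) ^ p := by
      have b1 := one_add_mul_le_pow (a := (1 / 13 : ℝ)) (by norm_num) p
      have hp' : (16 : ℝ) ≤ p := by exact_mod_cast hp0
      have b2 : (45 / 16 : ℝ) ^ p ≥ 2.6 ^ p * (1 + 1 / 13) ^ p := by
        rw [← mul_pow]; exact pow_le_pow_left₀ (by norm_num) (by norm_num) _
      have b3 : (1 : ℝ) ≤ 2.6 ^ p := one_le_pow₀ (by norm_num)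
      have b4 : (2.6 : ℝ) ^ p * (1 + 1 / 13) ^ p ≥ 2.6 ^ p * 2 :=
        mul_le_mul_of_nonneg_left (by linarith) (by positivity)
      linarith
    have : Real.exp (p / 4) * 2 ^ p ≤ (2.6 : ℝ) ^ p := by
      calc _ ≤ (1.3 : ℝ) ^ p * 2 ^ p := mul_le_mul_of_nonneg_right e1 (by positivity)
        _ = _ := by rw [← mul_pow]; norm_num
    linarith
  have h3 : Real.exp (p / 4) * 2 ^ p * (b ^ (16 * p) * n ^ 2) ≤
      Real.exp (p / 4) * ((a⁻¹ ^ 2) ^ (16 * p) * M) := by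
    have := mul_le_mul_of_nonneg_right key (by positivity : 0 ≤ b ^ (16 * p) * n ^ 2)
    linarith
  have h4 : 2 ^ p * (b ^ (16 * p) * n ^ 2) ≤ (a⁻¹ ^ 2) ^ (16 * p) * M := by
    rw [mul_assoc] at h3
    exact le_of_mul_le_mul_left h3 (Real.exp_pos _)
  have h5 := mul_le_mul_of_nonneg_left h4 (by positivity : 0 ≤ (a ^ 2) ^ (16 * p))
  rw [← mul_assoc _ _ M, ← mul_pow (a ^ 2), ← mul_pow a, mul_inv_cancel₀ ha.ne'] at h5
  rw [mul_pow]
  simp only [one_pow, one_mul] at h5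
  linarith

end part1


section part2
variable {G : Type*} [AddCommGroup G] [Fintype G]

/-- common intersection set -/
noncomputable def siftD (A E : Finset G) {q : ℕ} (s : Fin q → G) : Finset G :=
  E.filter (fun u => ∀ i, s i + u ∈ A)

lemma prod_ind (A : Finset G) {q : ℕ} (s : Fin q → G) (u : G) :
    ∏ i, ind A (s i + u) = if ∀ i, s i + u ∈ A then 1 else 0 := by
  unfold ind
  rw [Finset.prod_ite_zero]
  simp

lemma sift_moment (A E : Finset G) (P : G → ℝ) (q : ℕ) :
    ∑ u ∈ E, ∑ v ∈ E, P (u - v) * cor (ind A) (ind A) (u - v) ^ q =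
      ∑ s : Fin q → G, ∑ u ∈ siftD A E s, ∑ v ∈ siftD A E s, P (u - v) := by
  simp_rw [cor_sub, Fintype.sum_pow, Finset.prod_mul_distrib, Finset.mul_sum]
  rw [sum3_comm]
  refine Finset.sum_congr rfl fun s _ => ?_
  simp_rw [prod_ind, siftD, Finset.sum_filter]
  refine Finset.sum_congr rfl fun u _ => ?_
  by_cases hu : ∀ i, s i + u ∈ A
  · simp only [hu, implies_true, if_true]
    refine Finset.sum_congr rfl fun v _ => ?_
    split_ifs <;> simp
  · simp [hu]

lemma sift {A E H : Finset G} {a b : ℝ} {p : ℕ} (hH : ∀ x ∈ A, ∀ u ∈ E, x - u ∈ H)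
    (hHc : (H.card : ℝ) ≤ 2 * b) (ha : 0 < a) (hb : 0 < b) (hE : E.Nonempty) (hp : 20 ≤ p)
    (hV : (2 : ℝ) ^ p * (a ^ 2 * b) ^ (16 * p) * (E.card : ℝ) ^ 2 ≤
      ∑ u ∈ E, ∑ v ∈ E, cor (ind A) (ind A) (u - v) ^ (16 * p)) :
    ∃ D ⊆ E, (a ^ 2 / 2) ^ (8 * p) * E.card ≤ D.card ∧
      ∑ u ∈ D, ∑ v ∈ D, (if cor (ind A) (ind A) (u - v) < 65 / 64 * (a ^ 2 * b) then (1 : ℝ) else 0)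
        ≤ (D.card : ℝ) ^ 2 / 1000 := by
  set q := 16 * p with hq
  set V := ∑ u ∈ E, ∑ v ∈ E, cor (ind A) (ind A) (u - v) ^ q with hVd
  set P : G → ℝ := fun t => if cor (ind A) (ind A) t < 65 / 64 * (a ^ 2 * b) then (1 : ℝ) else 0 with hP
  have hP0 : ∀ t, 0 ≤ P t := fun t => by simp only [hP]; split_ifs <;> norm_num
  have hEc : (0 : ℝ) < E.card := by exact_mod_cast hE.card_pos
  have hV0 : 0 < V := lt_of_lt_of_le (by positivity) hV
  by_contra hcon
  push Not at hcon
  have hR0 : ∀ t, 0 ≤ cor (ind A) (ind A) t := fun t =>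
    Finset.sum_nonneg fun x _ => mul_nonneg (ind_nonneg _ _) (ind_nonneg _ _)
  have hV1 : V = ∑ s : Fin q → G, ((siftD A E s).card : ℝ) ^ 2 := by
    have := sift_moment A E (fun _ => 1) q
    simp only [one_mul, Finset.sum_const, nsmul_eq_mul, mul_one] at this
    rw [hVd, this]
    simp [pow_two]
  have hBad : ∑ s : Fin q → G, ∑ u ∈ siftD A E s, ∑ v ∈ siftD A E s, P (u - v) ≤
      (65 / 64 * (a ^ 2 * b)) ^ q * (E.card : ℝ) ^ 2 := by
    rw [← sift_moment]
    calc _ ≤ ∑ u ∈ E, ∑ v ∈ E, (65 / 64 * (a ^ 2 * b)) ^ q := by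
          refine Finset.sum_le_sum fun u _ => Finset.sum_le_sum fun v _ => ?_
          simp only [hP]
          split_ifs with h
          · rw [one_mul]; exact pow_le_pow_left₀ (hR0 _) h.le _
          · rw [zero_mul]; positivity
      _ = _ := by simp; ring
  have key : ∀ s : Fin q → G, ((siftD A E s).card : ℝ) ^ 2 ≤
      (if s ∈ Fintype.piFinset (fun _ : Fin q => H) then (a ^ 2 / 2) ^ q * (E.card : ℝ) ^ 2 else 0) +
      1000 * ∑ u ∈ siftD A E s, ∑ v ∈ siftD A E s, P (u - v) := by
    intro s
    have hbad0 : 0 ≤ ∑ u ∈ siftD A E s, ∑ v ∈ siftD A E s, P (u - v) :=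
      Finset.sum_nonneg fun u _ => Finset.sum_nonneg fun v _ => hP0 _
    rcases (siftD A E s).eq_empty_or_nonempty with h0 | ⟨u, hu⟩
    · rw [h0]; simp only [Finset.card_empty]
      split_ifs
      · simp; positivity
      · simp
    · have hs : s ∈ Fintype.piFinset (fun _ : Fin q => H) := by
        rw [Fintype.mem_piFinset]
        intro i
        simp only [siftD, Finset.mem_filter] at hu
        have := hH _ (hu.2 i) u hu.1
        simpa using this
      rw [if_pos hs]
      by_cases hc : (a ^ 2 / 2) ^ (8 * p) * E.card ≤ (siftD A E s).card
      · have := hcon _ (Finset.filter_subset _ _) hc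
        have h2 : (0 : ℝ) ≤ (a ^ 2 / 2) ^ q * (E.card : ℝ) ^ 2 := by positivity
        change _ < ∑ u ∈ siftD A E s, ∑ v ∈ siftD A E s, P (u - v) at this
        change ((siftD A E s).card : ℝ) ^ 2 / 1000 < _ at this
        linarith
      · push Not at hc
        have h3 := pow_le_pow_left₀ (by positivity) hc.le 2
        have h4 : ((a ^ 2 / 2) ^ (8 * p) * (E.card : ℝ)) ^ 2 = (a ^ 2 / 2) ^ q * (E.card : ℝ) ^ 2 := by
          rw [mul_pow, ← pow_mul, hq]; congr 2; ring
        rw [h4] at h3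
        linarith
  have hsum := Finset.sum_le_sum (fun s (_ : s ∈ (Finset.univ : Finset (Fin q → G))) => key s)
  rw [← hV1, Finset.sum_add_distrib, ← Finset.mul_sum, Finset.sum_ite_mem, Finset.univ_inter,
    Finset.sum_const, Fintype.card_piFinset_const, nsmul_eq_mul] at hsum
  push_cast at hsum
  set X := (a ^ 2 * b) ^ q * (E.card : ℝ) ^ 2 with hX
  have hX0 : 0 ≤ X := by positivity
  have h5 : (H.card : ℝ) ^ q * ((a ^ 2 / 2) ^ q * (E.card : ℝ) ^ 2) ≤ X := by
    calc _ ≤ (2 * b) ^ q * ((a ^ 2 / 2) ^ q * (E.card : ℝ) ^ 2) := by gcongr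
      _ = X := by rw [hX, ← mul_assoc, ← mul_pow]; congr 2; ring
  have h6 : (65 / 64 * (a ^ 2 * b)) ^ q * (E.card : ℝ) ^ 2 ≤ (13 / 10) ^ p * X := by
    rw [mul_pow, mul_assoc, ← hX, hq, pow_mul]
    gcongr
    norm_num
  have h7 : X * 2 ^ p ≤ V := by rw [hX]; linarith
  have h8 : (13 / 10 : ℝ) ^ p * 2000 ≤ 2 ^ p := by
    have : (2 : ℝ) ^ p = (13 / 10) ^ p * (20 / 13) ^ p := by rw [← mul_pow]; norm_num
    rw [this]
    gcongr
    calc (2000 : ℝ) ≤ (20 / 13) ^ 20 := by norm_num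
      _ ≤ _ := pow_le_pow_right₀ (by norm_num) hp
  have h9 : (1000 : ℝ) ≤ 2 ^ p := by
    calc (1000 : ℝ) ≤ 2 ^ 20 := by norm_num
      _ ≤ _ := pow_le_pow_right₀ (by norm_num) hp
  have h10 : 2000 * ((13 / 10) ^ p * X) ≤ V := le_trans (by nlinarith) h7
  have h11 : 1000 * X ≤ V := le_trans (by nlinarith) h7
  linarith

end part2


section part3
variable {G : Type*} [AddCommGroup G] [Fintype G]

lemma hoeff_one (D : Finset G) (g : G → ℝ) (hg : ∀ u, |g u| ≤ 1) (h0 : ∑ u ∈ D, g u = 0)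
    {δ : ℝ} (hδ : 0 < δ) (hδ1 : δ ≤ 1) (m : ℕ) :
    (((Fintype.piFinset (fun _ : Fin m => D)).filter (fun y => m * δ < ∑ i, g (y i))).card : ℝ) ≤
      Real.exp (-(m * δ ^ 2 / 4)) * (D.card : ℝ) ^ m := by
  set s := δ / 2 with hs
  have hs0 : 0 < s := by positivity
  have h1 : ∑ u ∈ D, Real.exp (s * g u) ≤ D.card * Real.exp (s ^ 2) := by
    calc _ ≤ ∑ u ∈ D, (1 + s * g u + s ^ 2) := by
          refine Finset.sum_le_sum fun u _ => ?_
          have hsg : |s * g u| ≤ s := by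
            rw [abs_mul, abs_of_pos hs0]
            nlinarith [hg u]
          have := Real.abs_exp_sub_one_sub_id_le (x := s * g u) (by linarith)
          have h2 := le_abs_self (Real.exp (s * g u) - 1 - s * g u)
          have h3 : (s * g u) ^ 2 ≤ s ^ 2 := by
            rw [← sq_abs]; exact pow_le_pow_left₀ (abs_nonneg _) hsg 2
          linarith
      _ = D.card * (s ^ 2 + 1) := by
          rw [Finset.sum_add_distrib, Finset.sum_add_distrib, ← Finset.mul_sum, h0]
          simp; ring
      _ ≤ _ := by gcongr; exact Real.add_one_le_exp _
  have h2 : ∑ y ∈ Fintype.piFinset (fun _ : Fin m => D), Real.exp (s * ∑ i, g (y i)) =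
      (∑ u ∈ D, Real.exp (s * g u)) ^ m := by
    simp_rw [Finset.mul_sum, Real.exp_sum]
    rw [← Finset.prod_univ_sum (fun _ : Fin m => D) (fun _ u => Real.exp (s * g u))]
    simp
  have h3 : (((Fintype.piFinset (fun _ : Fin m => D)).filter (fun y => m * δ < ∑ i, g (y i))).card : ℝ)
      * Real.exp (s * (m * δ)) ≤ ∑ y ∈ Fintype.piFinset (fun _ : Fin m => D), Real.exp (s * ∑ i, g (y i)) := by
    calc _ = ∑ y ∈ (Fintype.piFinset (fun _ : Fin m => D)).filter (fun y => m * δ < ∑ i, g (y i)),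
          Real.exp (s * (m * δ)) := by simp
      _ ≤ ∑ y ∈ (Fintype.piFinset (fun _ : Fin m => D)).filter (fun y => m * δ < ∑ i, g (y i)),
          Real.exp (s * ∑ i, g (y i)) := by
          refine Finset.sum_le_sum fun y hy => ?_
          rw [Finset.mem_filter] at hy
          gcongr
          exact hy.2.le
      _ ≤ _ := Finset.sum_le_sum_of_subset_of_nonneg (Finset.filter_subset _ _)
          fun _ _ _ => (Real.exp_pos _).le
  have h4 : (∑ u ∈ D, Real.exp (s * g u)) ^ m ≤ (D.card : ℝ) ^ m * Real.exp (m * s ^ 2) := by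
    calc _ ≤ (D.card * Real.exp (s ^ 2)) ^ m :=
          pow_le_pow_left₀ (Finset.sum_nonneg fun _ _ => (Real.exp_pos _).le) h1 m
      _ = _ := by rw [mul_pow, ← Real.exp_nat_mul]
  have h5 : Real.exp (-(m * δ ^ 2 / 4)) * Real.exp (s * (m * δ)) = Real.exp (m * s ^ 2) := by
    rw [← Real.exp_add]; congr 1; rw [hs]; ring
  have h6 := h3.trans (h2.le.trans h4)
  rw [← h5] at h6
  have hpos := Real.exp_pos (s * (m * δ))
  nlinarith [h6]

/-- average of `f(u - x)` over `u ∈ D` -/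
noncomputable def avgF (f : G → ℝ) (D : Finset G) (x : G) : ℝ := (D.card : ℝ)⁻¹ * ∑ u ∈ D, f (u - x)

lemma avgF_bounds {f : G → ℝ} (hf : ∀ x, 0 ≤ f x ∧ f x ≤ 1) {D : Finset G} (hD : D.Nonempty) (x : G) :
    0 ≤ avgF f D x ∧ avgF f D x ≤ 1 := by
  have hDc : (0 : ℝ) < D.card := by exact_mod_cast hD.card_pos
  unfold avgF
  constructor
  · exact mul_nonneg (by positivity) (Finset.sum_nonneg fun _ _ => (hf _).1)
  · rw [inv_mul_le_iff₀ hDc, mul_one]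
    calc _ ≤ ∑ u ∈ D, (1 : ℝ) := Finset.sum_le_sum fun _ _ => (hf _).2
      _ = _ := by simp

lemma hoeff_two {f : G → ℝ} (hf : ∀ x, 0 ≤ f x ∧ f x ≤ 1) {D : Finset G} (hD : D.Nonempty) (x : G)
    {δ : ℝ} (hδ : 0 < δ) (hδ1 : δ ≤ 1) {m : ℕ} :
    (((Fintype.piFinset (fun _ : Fin m => D)).filter
      (fun y => m * δ < |m * avgF f D x - ∑ i, f (y i - x)|)).card : ℝ) ≤
      2 * Real.exp (-(m * δ ^ 2 / 4)) * (D.card : ℝ) ^ m := by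
  have hDc : (0 : ℝ) < D.card := by exact_mod_cast hD.card_pos
  have hb := avgF_bounds hf hD x
  have hs : ∑ u ∈ D, f (u - x) = D.card * avgF f D x := by
    unfold avgF; field_simp
  have h1 := hoeff_one D (fun u => avgF f D x - f (u - x)) (fun u => by
    rw [abs_le]; constructor <;> linarith [(hf (u - x)).1, (hf (u - x)).2]) (by
      rw [Finset.sum_sub_distrib, hs]; simp) hδ hδ1 m
  have h2 := hoeff_one D (fun u => f (u - x) - avgF f D x) (fun u => by
    rw [abs_le]; constructor <;> linarith [(hf (u - x)).1, (hf (u - x)).2]) (by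
      rw [Finset.sum_sub_distrib, hs]; simp) hδ hδ1 m
  simp only [Finset.sum_sub_distrib, Finset.sum_const, Finset.card_univ, Fintype.card_fin,
    nsmul_eq_mul] at h1 h2
  have h3 : (Fintype.piFinset (fun _ : Fin m => D)).filter
      (fun y => m * δ < |m * avgF f D x - ∑ i, f (y i - x)|) ⊆
      (Fintype.piFinset (fun _ : Fin m => D)).filter (fun y => m * δ < m * avgF f D x - ∑ i, f (y i - x)) ∪
      (Fintype.piFinset (fun _ : Fin m => D)).filter (fun y => m * δ < ∑ i, f (y i - x) - m * avgF f D x) := by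
    intro y hy
    rw [Finset.mem_filter, lt_abs, neg_sub] at hy
    rw [Finset.mem_union, Finset.mem_filter, Finset.mem_filter]
    tauto
  have h4 := (Finset.card_le_card h3).trans (Finset.card_union_le _ _)
  have h5 : (((Fintype.piFinset (fun _ : Fin m => D)).filter
      (fun y => m * δ < |m * avgF f D x - ∑ i, f (y i - x)|)).card : ℝ) ≤
      (((Fintype.piFinset (fun _ : Fin m => D)).filter
        (fun y => m * δ < m * avgF f D x - ∑ i, f (y i - x))).card : ℝ) +
      (((Fintype.piFinset (fun _ : Fin m => D)).filter
        (fun y => m * δ < ∑ i, f (y i - x) - m * avgF f D x)).card : ℝ) := by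
    exact_mod_cast h4
  linarith

lemma croot_sisask {f : G → ℝ} (hf : ∀ x, 0 ≤ f x ∧ f x ≤ 1) {D E W : Finset G} (hD : D.Nonempty)
    (hE : E.Nonempty) (hW : ∀ u ∈ D, ∀ t ∈ E, u - t ∈ W) {δ : ℝ} (hδ : 0 < δ) (hδ1 : δ ≤ 1) {m : ℕ}
    (hm : 0 < m) :
    ∃ T ⊆ E, 1 / 2 * ((D.card : ℝ) / W.card) ^ m * E.card ≤ T.card ∧ ∀ t ∈ T, ∀ t' ∈ T,
      ((W.filter (fun x => x - t + t' ∈ W ∧ 2 * δ < |avgF f D x - avgF f D (x - t + t')|)).card : ℝ) ≤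
        8 * Real.exp (-(m * δ ^ 2 / 4)) * W.card := by
  have hDc : (0 : ℝ) < D.card := by exact_mod_cast hD.card_pos
  have hEc : (0 : ℝ) < E.card := by exact_mod_cast hE.card_pos
  obtain ⟨u0, hu0⟩ := hD
  obtain ⟨t0, ht0⟩ := hE
  have hWc : (0 : ℝ) < W.card := by exact_mod_cast (Finset.card_pos.2 ⟨_, hW u0 hu0 t0 ht0⟩)
  have hD : D.Nonempty := ⟨u0, hu0⟩
  set κ := 4 * Real.exp (-(m * δ ^ 2 / 4)) with hκ
  have hκ0 : 0 < κ := by positivity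
  set P := Fintype.piFinset (fun _ : Fin m => D) with hP
  have hPc : (P.card : ℝ) = (D.card : ℝ) ^ m := by rw [hP, Fintype.card_piFinset_const]; push_cast; rfl
  set bad : (Fin m → G) → Finset G := fun y =>
    W.filter (fun x => m * δ < |m * avgF f D x - ∑ i, f (y i - x)|) with hbad
  set Good := P.filter (fun y => ((bad y).card : ℝ) ≤ κ * W.card) with hGood
  have hsum : ∑ y ∈ P, ((bad y).card : ℝ) ≤ κ / 2 * (D.card : ℝ) ^ m * W.card := by
    have : ∑ y ∈ P, ((bad y).card : ℝ) = ∑ x ∈ W, ((P.filter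
      (fun y => m * δ < |m * avgF f D x - ∑ i, f (y i - x)|)).card : ℝ) := by
      simp only [hbad, Finset.card_filter]
      push_cast
      rw [Finset.sum_comm]
    rw [this]
    calc _ ≤ ∑ x ∈ W, 2 * Real.exp (-(m * δ ^ 2 / 4)) * (D.card : ℝ) ^ m :=
          Finset.sum_le_sum fun x _ => hoeff_two hf hD x hδ hδ1
      _ = _ := by rw [Finset.sum_const, nsmul_eq_mul, hκ]; ring
  have hGc : 1 / 2 * (D.card : ℝ) ^ m ≤ Good.card := by
    have h1 : ((P.filter (fun y => ¬ ((bad y).card : ℝ) ≤ κ * W.card)).card : ℝ) * (κ * W.card) ≤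
        κ / 2 * (D.card : ℝ) ^ m * W.card := by
      refine le_trans ?_ hsum
      calc _ = ∑ y ∈ P.filter (fun y => ¬ ((bad y).card : ℝ) ≤ κ * W.card), κ * W.card := by simp
        _ ≤ ∑ y ∈ P.filter (fun y => ¬ ((bad y).card : ℝ) ≤ κ * W.card), ((bad y).card : ℝ) := by
          refine Finset.sum_le_sum fun y hy => ?_
          rw [Finset.mem_filter] at hy
          exact (not_le.1 hy.2).le
        _ ≤ _ := Finset.sum_le_sum_of_subset_of_nonneg (Finset.filter_subset _ _)
            fun _ _ _ => by positivity
    have h2 : (Good.card : ℝ) + ((P.filter (fun y => ¬ ((bad y).card : ℝ) ≤ κ * W.card)).card : ℝ) =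
        (D.card : ℝ) ^ m := by
      rw [← hPc, hGood]; exact_mod_cast Finset.card_filter_add_card_filter_not _
    have h3 : 0 < κ * W.card := by positivity
    have h4 : ((P.filter (fun y => ¬ ((bad y).card : ℝ) ≤ κ * W.card)).card : ℝ) ≤ 1 / 2 * (D.card : ℝ) ^ m := by
      refine le_of_mul_le_mul_right ?_ h3
      linarith
    linarith
  -- pigeonhole
  set Q := Fintype.piFinset (fun _ : Fin m => W) with hQ
  have hQc : (Q.card : ℝ) = (W.card : ℝ) ^ m := by rw [hQ, Fintype.card_piFinset_const]; push_cast; rfl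
  set TT : (Fin m → G) → Finset G := fun z => E.filter (fun t => (fun i => z i + t) ∈ Good) with hTT
  have hpig : (E.card : ℝ) * Good.card ≤ ∑ z ∈ Q, ((TT z).card : ℝ) := by
    have : ∑ z ∈ Q, ((TT z).card : ℝ) = ∑ t ∈ E, ((Q.filter (fun z => (fun i => z i + t) ∈ Good)).card : ℝ) := by
      simp only [hTT, Finset.card_filter]
      push_cast
      rw [Finset.sum_comm]
    rw [this, ← nsmul_eq_mul, ← Finset.sum_const]
    refine Finset.sum_le_sum fun t ht => ?_
    norm_cast
    refine Finset.card_le_card_of_injOn (fun y i => y i - t) ?_ ?_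
    · intro y hy
      simp only [Finset.coe_filter, Set.mem_ofPred_eq, hQ, Fintype.mem_piFinset, sub_add_cancel]
      refine ⟨fun i => ?_, hy⟩
      have hy' : y ∈ P := (Finset.mem_filter.1 hy).1
      rw [hP, Fintype.mem_piFinset] at hy'
      exact hW _ (hy' i) t ht
    · intro y _ y' _ h
      funext i
      have := congrFun h i
      simpa using this
  have hex : ∃ z ∈ Q, 1 / 2 * ((D.card : ℝ) / W.card) ^ m * E.card ≤ ((TT z).card : ℝ) := by
    by_contra hcon
    push Not at hcon
    have hQne : Q.Nonempty := by
      rw [← Finset.card_pos]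
      have : (0 : ℝ) < Q.card := by rw [hQc]; positivity
      exact_mod_cast this
    have h1 := Finset.sum_lt_sum_of_nonempty hQne hcon
    rw [Finset.sum_const, nsmul_eq_mul, hQc, div_pow] at h1
    have h2 : (W.card : ℝ) ^ m * (1 / 2 * ((D.card : ℝ) ^ m / (W.card : ℝ) ^ m) * E.card) =
      E.card * (1 / 2 * (D.card : ℝ) ^ m) := by field_simp
    rw [h2] at h1
    have h3 : (E.card : ℝ) * (1 / 2 * (D.card : ℝ) ^ m) ≤ E.card * Good.card := by gcongr
    linarith
  obtain ⟨z, -, hz⟩ := hex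
  refine ⟨TT z, Finset.filter_subset _ _, hz, fun t ht t' ht' => ?_⟩
  have hm0 : (0 : ℝ) < m := by exact_mod_cast hm
  have ht2 : ((bad fun i => z i + t).card : ℝ) ≤ κ * W.card :=
    (Finset.mem_filter.1 (Finset.mem_filter.1 ht).2).2
  have ht2' : ((bad fun i => z i + t').card : ℝ) ≤ κ * W.card :=
    (Finset.mem_filter.1 (Finset.mem_filter.1 ht').2).2
  have hsub : W.filter (fun x => x - t + t' ∈ W ∧ 2 * δ < |avgF f D x - avgF f D (x - t + t')|) ⊆
      (bad fun i => z i + t) ∪ (bad fun i => z i + t').image (fun x => x - t' + t) := by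
    intro x hx
    rw [Finset.mem_filter] at hx
    obtain ⟨hxW, hxW', hx⟩ := hx
    by_contra hcon
    rw [Finset.mem_union, not_or] at hcon
    obtain ⟨c1, c2⟩ := hcon
    have c2' : x - t + t' ∉ bad fun i => z i + t' := by
      intro h
      exact c2 (Finset.mem_image.2 ⟨_, h, by abel⟩)
    simp only [hbad, Finset.mem_filter, not_and, not_lt] at c1 c2'
    have d1 := c1 hxW
    have d2 := c2' hxW'
    have e1 : ∀ i, z i + t' - (x - t + t') = z i + t - x := fun i => by abel
    simp only [e1] at d2
    rw [abs_le] at d1 d2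
    have : |m * (avgF f D x - avgF f D (x - t + t'))| ≤ m * (2 * δ) := by
      rw [abs_le]; constructor <;> linarith
    rw [abs_mul, abs_of_pos hm0] at this
    have := le_of_mul_le_mul_left this hm0
    linarith
  have h1 : ((W.filter (fun x => x - t + t' ∈ W ∧ 2 * δ < |avgF f D x - avgF f D (x - t + t')|)).card : ℝ) ≤
      ((bad fun i => z i + t).card : ℝ) + ((bad fun i => z i + t').card : ℝ) := by
    exact_mod_cast (Finset.card_le_card hsub).trans ((Finset.card_union_le _ _).trans
      (Nat.add_le_add_left Finset.card_image_le _))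
  linarith

lemma cs_chain {F : G → ℝ} (hF : ∀ x, 0 ≤ F x ∧ F x ≤ 1) {D T W : Finset G} {δ κ : ℝ}
    (h : ∀ t ∈ T, ∀ t' ∈ T,
      ((W.filter (fun x => x - t + t' ∈ W ∧ 2 * δ < |F x - F (x - t + t')|)).card : ℝ) ≤ κ)
    (hδ : 0 < δ) {k : ℕ}
    (hW : ∀ j ≤ k, ∀ t t' : Fin j → G, (∀ i, t i ∈ T) → (∀ i, t' i ∈ T) → ∀ x ∈ D,
      x + (∑ i, t' i - ∑ i, t i) ∈ W) :
    ∀ j ≤ k, ∀ t t' : Fin j → G, (∀ i, t i ∈ T) → (∀ i, t' i ∈ T) →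
      ∑ x ∈ D, F x - j * (2 * δ * D.card + κ) ≤ ∑ x ∈ D, F (x + (∑ i, t' i - ∑ i, t i)) := by
  intro j
  induction j with
  | zero => intro _ t t' _ _; simp
  | succ j ih =>
    intro hj t t' ht ht'
    have h0 := ih (by omega) (fun i => t i.castSucc) (fun i => t' i.castSucc) (fun i => ht _) (fun i => ht' _)
    have hw1 := hW j (by omega) (fun i => t i.castSucc) (fun i => t' i.castSucc) (fun i => ht _) (fun i => ht' _)
    have hw2 := hW (j + 1) hj t t' ht ht'
    set w := ∑ i : Fin j, t' i.castSucc - ∑ i : Fin j, t i.castSucc with hw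
    have e1 : ∑ i, t' i - ∑ i, t i = w - t (Fin.last j) + t' (Fin.last j) := by
      rw [Fin.sum_univ_castSucc, Fin.sum_univ_castSucc, hw]; abel
    rw [e1] at hw2 ⊢
    set a := t (Fin.last j)
    set b := t' (Fin.last j)
    have hab := h a (ht _) b (ht' _)
    set Bd := W.filter (fun x => x - a + b ∈ W ∧ 2 * δ < |F x - F (x - a + b)|) with hBd
    have h1 : ∑ x ∈ D, F (x + w) ≤ ∑ x ∈ D, (F (x + (w - a + b)) + 2 * δ + ind Bd (x + w)) := by
      refine Finset.sum_le_sum fun x hx => ?_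
      have e2 : x + (w - a + b) = (x + w) - a + b := by abel
      have b1 := hF (x + w)
      have b2 := hF (x + (w - a + b))
      by_cases hb : x + w ∈ Bd
      · simp only [ind, hb, if_true]; linarith
      · have b3 := hb
        simp only [hBd, Finset.mem_filter, not_and, not_lt] at b3
        have b4 := b3 (hw1 x hx) (by rw [← e2]; exact hw2 x hx)
        rw [← e2, abs_le] at b4
        have := ind_nonneg Bd (x + w)
        linarith [b4.2]
    have h2 : ∑ x ∈ D, ind Bd (x + w) ≤ κ := by
      refine le_trans ?_ hab
      calc _ ≤ ∑ x, ind Bd (x + w) :=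
            Finset.sum_le_sum_of_subset_of_nonneg (Finset.subset_univ _) fun _ _ _ => ind_nonneg _ _
        _ = ∑ x, ind Bd x := Equiv.sum_comp (Equiv.addRight w) (ind Bd)
        _ = _ := sum_ind _
    rw [Finset.sum_add_distrib, Finset.sum_add_distrib, Finset.sum_const, nsmul_eq_mul] at h1
    push_cast
    linarith

end part3


section part4
variable {G : Type*} [AddCommGroup G] [Fintype G]

lemma char_sum (γ : AddChar G ℂ) {ι : Type*} (s : Finset ι) (t : ι → G) :
    γ (∑ i ∈ s, t i) = ∏ i ∈ s, γ (t i) := by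
  induction s using Finset.induction_on with
  | empty => simp
  | insert i s hi ih => rw [Finset.sum_insert hi, Finset.prod_insert hi, AddChar.map_add_eq_mul, ih]

/-- exponential sum over a finset -/
noncomputable def ch (D : Finset G) (γ : AddChar G ℂ) : ℂ := ∑ x ∈ D, γ x

lemma ch_norm_le (D : Finset G) (γ : AddChar G ℂ) : ‖ch D γ‖ ≤ D.card := by
  unfold ch
  calc _ ≤ ∑ x ∈ D, ‖γ x‖ := norm_sum_le _ _
    _ = D.card := by simp [AddChar.norm_apply]

lemma mul_conj_norm (z : ℂ) : z * (starRingEnd ℂ) z = ((‖z‖ ^ 2 : ℝ) : ℂ) := by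
  rw [Complex.mul_conj, Complex.normSq_eq_norm_sq]

lemma cor_fourier (A : Finset G) (y : G) :
    (Fintype.card G : ℂ) * (cor (ind A) (ind A) y : ℂ) =
      ∑ γ : AddChar G ℂ, ((‖ch A γ‖ ^ 2 : ℝ) : ℂ) * γ y := by
  have h1 : ∀ γ : AddChar G ℂ, ((‖ch A γ‖ ^ 2 : ℝ) : ℂ) * γ y = ∑ x ∈ A, ∑ x' ∈ A, γ (x + y - x') := by
    intro γ
    rw [← mul_conj_norm, ch, map_sum, Finset.sum_mul_sum, Finset.sum_mul]
    refine Finset.sum_congr rfl fun x _ => ?_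
    rw [Finset.sum_mul]
    refine Finset.sum_congr rfl fun x' _ => ?_
    rw [← AddChar.map_neg_eq_conj, sub_eq_add_neg, AddChar.map_add_eq_mul, AddChar.map_add_eq_mul]
    ring
  simp_rw [h1]
  rw [Finset.sum_comm]
  simp_rw [Finset.sum_comm (s := (Finset.univ : Finset (AddChar G ℂ))), AddChar.sum_apply_eq_ite, sub_eq_zero]
  simp only [Finset.sum_ite_eq]
  unfold cor
  rw [sum_ind_mul]
  simp only [ind]
  push_cast
  rw [Finset.mul_sum]
  refine Finset.sum_congr rfl fun x _ => ?_
  split_ifs <;> simp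

lemma fourier_step (A : Finset G) {ι : Type*} (I : Finset ι) (y : ι → G) (m : AddChar G ℂ → ℝ)
    (hm0 : ∀ γ, 0 ≤ m γ) (hm : ∀ γ : AddChar G ℂ, ∑ i ∈ I, γ (y i) = (m γ : ℂ)) {ε δ X : ℝ} (hX : 0 ≤ X) (hε : 0 ≤ ε)
    (hδ : 0 ≤ δ) (b : G)
    (hb : ∀ γ : AddChar G ℂ, m γ ≤ ε * X ∨ ‖γ b - 1‖ ≤ δ) :
    (1 - δ) * ∑ i ∈ I, cor (ind A) (ind A) (y i) - 2 * ε * X * A.card ≤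
      ∑ i ∈ I, cor (ind A) (ind A) (y i + b) := by
  set g : ℝ := (Fintype.card G : ℝ) with hg
  have hg0 : 0 < g := by rw [hg]; exact_mod_cast Fintype.card_pos
  have h1 : ∀ b : G, ((g * ∑ i ∈ I, cor (ind A) (ind A) (y i + b) : ℝ) : ℂ) =
      ∑ γ : AddChar G ℂ, ((‖ch A γ‖ ^ 2 * m γ : ℝ) : ℂ) * γ b := by
    intro b
    push_cast
    rw [Finset.mul_sum]
    have : ∀ i, (g : ℂ) * (cor (ind A) (ind A) (y i + b) : ℂ) =
        ∑ γ : AddChar G ℂ, ((‖ch A γ‖ ^ 2 : ℝ) : ℂ) * γ (y i + b) := fun i => by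
      rw [← cor_fourier A (y i + b), hg, Complex.ofReal_natCast]
    simp_rw [this]
    rw [Finset.sum_comm]
    refine Finset.sum_congr rfl fun γ _ => ?_
    rw [← Finset.mul_sum, ← hm, mul_assoc, Finset.sum_mul]
    push_cast
    congr 1
    exact Finset.sum_congr rfl fun i _ => AddChar.map_add_eq_mul _ _ _
  have h0 : g * ∑ i ∈ I, cor (ind A) (ind A) (y i) = ∑ γ : AddChar G ℂ, ‖ch A γ‖ ^ 2 * m γ := by
    have := h1 0
    simp only [add_zero, AddChar.map_zero_eq_one, mul_one] at this
    exact_mod_cast this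
  have hA : ∑ γ : AddChar G ℂ, ‖ch A γ‖ ^ 2 = g * A.card := by
    have := cor_fourier A 0
    simp only [AddChar.map_zero_eq_one, mul_one] at this
    have h2 : cor (ind A) (ind A) 0 = A.card := by
      unfold cor
      rw [sum_ind_mul]
      simp [ind]
    rw [h2] at this
    rw [hg]
    exact_mod_cast this.symm
  have h3 : g * ∑ i ∈ I, cor (ind A) (ind A) (y i) - g * ∑ i ∈ I, cor (ind A) (ind A) (y i + b) ≤
      ∑ γ : AddChar G ℂ, ‖ch A γ‖ ^ 2 * m γ * ‖γ b - 1‖ := by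
    have h4 : ((g * ∑ i ∈ I, cor (ind A) (ind A) (y i) - g * ∑ i ∈ I, cor (ind A) (ind A) (y i + b) : ℝ) : ℂ) =
        ∑ γ : AddChar G ℂ, ((‖ch A γ‖ ^ 2 * m γ : ℝ) : ℂ) * (1 - γ b) := by
      rw [Complex.ofReal_sub, h1 b, h0, Complex.ofReal_sum, ← Finset.sum_sub_distrib]
      exact Finset.sum_congr rfl fun γ _ => by ring
    refine (le_abs_self _).trans ?_
    rw [← Real.norm_eq_abs, ← Complex.norm_real, h4]
    refine (norm_sum_le _ _).trans (le_of_eq ?_)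
    refine Finset.sum_congr rfl fun γ _ => ?_
    rw [norm_mul, Complex.norm_real, Real.norm_of_nonneg (mul_nonneg (by positivity) (hm0 γ)), norm_sub_rev]
  have h5 : ∑ γ : AddChar G ℂ, ‖ch A γ‖ ^ 2 * m γ * ‖γ b - 1‖ ≤
      ∑ γ : AddChar G ℂ, (δ * (‖ch A γ‖ ^ 2 * m γ) + 2 * ε * X * ‖ch A γ‖ ^ 2) := by
    refine Finset.sum_le_sum fun γ _ => ?_
    have hn : ‖γ b - 1‖ ≤ 2 := by
      refine (norm_sub_le _ _).trans ?_
      rw [AddChar.norm_apply]; norm_num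
    have hp : 0 ≤ ‖ch A γ‖ ^ 2 := by positivity
    have hq : 0 ≤ ‖ch A γ‖ ^ 2 * m γ := mul_nonneg hp (hm0 γ)
    have hx : 0 ≤ ε * X * ‖ch A γ‖ ^ 2 := by positivity
    rcases hb γ with h | h
    · have h6 : ‖ch A γ‖ ^ 2 * m γ ≤ ‖ch A γ‖ ^ 2 * (ε * X) := mul_le_mul_of_nonneg_left h hp
      have h7 : ‖ch A γ‖ ^ 2 * m γ * ‖γ b - 1‖ ≤ ‖ch A γ‖ ^ 2 * m γ * 2 := mul_le_mul_of_nonneg_left hn hq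
      have h8 : 0 ≤ δ * (‖ch A γ‖ ^ 2 * m γ) := mul_nonneg hδ hq
      linarith
    · have h7 : ‖ch A γ‖ ^ 2 * m γ * ‖γ b - 1‖ ≤ ‖ch A γ‖ ^ 2 * m γ * δ := mul_le_mul_of_nonneg_left h hq
      linarith
  rw [Finset.sum_add_distrib, ← Finset.mul_sum, ← Finset.mul_sum, hA, ← h0] at h5
  have h9 := h3.trans h5
  refine le_of_mul_le_mul_left ?_ hg0
  linarith

lemma tuple_char (T : Finset G) (k : ℕ) (γ : AddChar G ℂ) :
    ∑ t ∈ Fintype.piFinset (fun _ : Fin k => T), γ (∑ i, t i) = ch T γ ^ k := by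
  simp_rw [char_sum]
  rw [← Finset.prod_univ_sum (fun _ : Fin k => T) (fun _ u => γ u)]
  simp [ch]

lemma tuple_char_neg (T : Finset G) (k : ℕ) (γ : AddChar G ℂ) :
    ∑ t ∈ Fintype.piFinset (fun _ : Fin k => T), γ (-∑ i, t i) = (starRingEnd ℂ) (ch T γ) ^ k := by
  simp_rw [AddChar.map_neg_eq_conj]
  rw [← map_sum, tuple_char, map_pow]

/-- index set for the average -/
noncomputable def idx (D T : Finset G) (k : ℕ) : Finset ((G × G) × ((Fin k → G) × (Fin k → G))) :=
  (D ×ˢ D) ×ˢ ((Fintype.piFinset (fun _ : Fin k => T)) ×ˢ (Fintype.piFinset (fun _ : Fin k => T)))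

/-- point -/
def idxp {k : ℕ} (i : (G × G) × ((Fin k → G) × (Fin k → G))) : G :=
  i.1.1 - (i.1.2 + (∑ j, i.2.2 j - ∑ j, i.2.1 j))

lemma idx_char (D T : Finset G) (k : ℕ) (γ : AddChar G ℂ) :
    ∑ i ∈ idx D T k, γ (idxp i) = ((‖ch D γ‖ ^ 2 * ‖ch T γ‖ ^ (2 * k) : ℝ) : ℂ) := by
  have h1 : ∀ i : (G × G) × ((Fin k → G) × (Fin k → G)), γ (idxp i) =
      (γ i.1.1 * γ (-i.1.2)) * (γ (∑ j, i.2.1 j) * γ (-∑ j, i.2.2 j)) := by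
    intro i
    rw [← AddChar.map_add_eq_mul, ← AddChar.map_add_eq_mul, ← AddChar.map_add_eq_mul]
    congr 1
    unfold idxp
    abel
  have hc : ∑ x ∈ D, γ (-x) = (starRingEnd ℂ) (ch D γ) := by
    simp_rw [AddChar.map_neg_eq_conj]
    rw [← map_sum]; rfl
  simp_rw [h1]
  rw [idx, Finset.sum_product]
  simp_rw [← Finset.mul_sum]
  rw [← Finset.sum_mul]
  rw [Finset.sum_product, Finset.sum_product]
  simp_rw [← Finset.mul_sum]
  rw [← Finset.sum_mul, ← Finset.sum_mul, tuple_char, tuple_char_neg, hc]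
  change ch D γ * _ * _ = _
  rw [mul_conj_norm, ← mul_pow, mul_conj_norm]
  push_cast
  rw [pow_mul]

lemma idx_card (D T : Finset G) (k : ℕ) : (idx D T k).card = D.card ^ 2 * T.card ^ (2 * k) := by
  simp only [idx, Finset.card_product, Fintype.card_piFinset_const]
  ring

/-- from the average to a translate -/
lemma fourier_conclude {A D T B4 : Finset G} {k : ℕ} {δ X : ℝ} (hδ : 0 ≤ δ) (hδ1 : δ ≤ 1)
    (hD : D.Nonempty) (hT : T.Nonempty)
    (hb : ∀ γ : AddChar G ℂ, (1 / 2 : ℝ) * T.card ≤ ‖ch T γ‖ → ∀ b ∈ B4, ‖γ b - 1‖ ≤ δ)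
    (hX : X * (idx D T k).card ≤ ∑ i ∈ idx D T k, cor (ind A) (ind A) (idxp i)) :
    ∃ z, ((1 - δ) * X - 2 * (1 / 4) ^ k * A.card) * B4.card ≤
      A.card * (B4.filter (fun b => z + b ∈ A)).card := by
  have hDc : (0 : ℝ) < D.card := by exact_mod_cast hD.card_pos
  have hTc : (0 : ℝ) < T.card := by exact_mod_cast hT.card_pos
  have hIc : ((idx D T k).card : ℝ) = (D.card : ℝ) ^ 2 * (T.card : ℝ) ^ (2 * k) := by
    rw [idx_card]; push_cast; rfl
  have hI0 : (0 : ℝ) < (idx D T k).card := by rw [hIc]; positivity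
  have h1 : ∀ b ∈ B4, ((1 - δ) * X - 2 * (1 / 4) ^ k * A.card) * (idx D T k).card ≤
      ∑ i ∈ idx D T k, cor (ind A) (ind A) (idxp i + b) := by
    intro b hb4
    have := fourier_step A (idx D T k) idxp (fun γ => ‖ch D γ‖ ^ 2 * ‖ch T γ‖ ^ (2 * k))
      (fun γ => by positivity) (fun γ => idx_char D T k γ) hI0.le (ε := (1 / 4) ^ k) (by positivity) hδ b
      (fun γ => by
        by_cases hγ : (1 / 2 : ℝ) * T.card ≤ ‖ch T γ‖
        · exact Or.inr (hb γ hγ b hb4)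
        · left
          push Not at hγ
          rw [hIc]
          have e1 : (1 / 4 : ℝ) ^ k * ((D.card : ℝ) ^ 2 * (T.card : ℝ) ^ (2 * k)) =
              (D.card : ℝ) ^ 2 * ((1 / 2 : ℝ) * T.card) ^ (2 * k) := by
            rw [mul_pow, pow_mul (1 / 2 : ℝ)]; norm_num; ring
          rw [e1]
          have := ch_norm_le D γ
          gcongr)
    refine le_trans ?_ this
    have h2 : (1 - δ) * (X * (idx D T k).card) ≤ (1 - δ) * ∑ i ∈ idx D T k, cor (ind A) (ind A) (idxp i) :=
      mul_le_mul_of_nonneg_left hX (by linarith)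
    linarith
  by_contra hcon
  push Not at hcon
  set Y := (1 - δ) * X - 2 * (1 / 4) ^ k * A.card with hY
  have h2 : Y * (idx D T k).card * B4.card ≤ ∑ i ∈ idx D T k, ∑ b ∈ B4, cor (ind A) (ind A) (idxp i + b) := by
    rw [Finset.sum_comm]
    calc _ = ∑ b ∈ B4, Y * (idx D T k).card := by simp; ring
      _ ≤ _ := Finset.sum_le_sum h1
  have h3 : ∀ y : G, ∑ b ∈ B4, cor (ind A) (ind A) (y + b) =
      ∑ x ∈ A, ((B4.filter (fun b => x + y + b ∈ A)).card : ℝ) := by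
    intro y
    unfold cor
    simp_rw [sum_ind_mul]
    rw [Finset.sum_comm]
    refine Finset.sum_congr rfl fun x _ => ?_
    simp only [ind, ← add_assoc, Finset.sum_boole]
  rcases A.eq_empty_or_nonempty with hA | hA
  · have h4 := hcon 0
    have hA0 : (A.card : ℝ) = 0 := by rw [hA]; simp
    rw [hA0, zero_mul] at h4
    simp_rw [h3, hA, Finset.sum_empty] at h2
    rw [Finset.sum_const_zero] at h2
    nlinarith
  · have hAc : (0 : ℝ) < A.card := by exact_mod_cast hA.card_pos
    have h4 : ∀ y : G, (∑ b ∈ B4, cor (ind A) (ind A) (y + b)) < Y * B4.card := by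
      intro y
      rw [h3]
      have h5 : ∑ x ∈ A, ((A.card : ℝ) * (B4.filter (fun b => x + y + b ∈ A)).card) < ∑ x ∈ A, Y * B4.card :=
        Finset.sum_lt_sum_of_nonempty hA fun x _ => hcon (x + y)
      rw [← Finset.mul_sum, Finset.sum_const, nsmul_eq_mul] at h5
      exact lt_of_mul_lt_mul_left h5 hAc.le
    have hIne : (idx D T k).Nonempty := by
      rw [← Finset.card_pos]; exact_mod_cast hI0
    have h6 := Finset.sum_lt_sum_of_nonempty hIne (fun i _ => h4 (idxp i))
    rw [Finset.sum_const, nsmul_eq_mul] at h6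
    linarith

end part4


section part5
variable {G : Type*} [AddCommGroup G] [Fintype G]

/-- product of characters with exponents -/
noncomputable def chi (c : AddChar G ℂ → ℤ) (x : G) : ℂ := ∏ γ : AddChar G ℂ, (γ x) ^ (c γ)

lemma char_ne_zero (γ : AddChar G ℂ) (x : G) : γ x ≠ 0 := by
  rw [← norm_pos_iff, AddChar.norm_apply]; norm_num

lemma chi_norm (c : AddChar G ℂ → ℤ) (x : G) : ‖chi c x‖ = 1 := by
  simp [chi, AddChar.norm_apply]

lemma chi_add (c : AddChar G ℂ → ℤ) (x y : G) : chi c (x + y) = chi c x * chi c y := by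
  simp only [chi, AddChar.map_add_eq_mul, mul_zpow, Finset.prod_mul_distrib]

/-- almost invariance of the set forces small variation -/
lemma chi_close (c : AddChar G ℂ → ℤ) (E : Finset G) {η θ : ℝ} (hθ : 0 < θ) (hE : E.Nonempty) (b : G)
    (h1 : ((E.filter (fun x => x + b ∉ E)).card : ℝ) ≤ η * E.card)
    (h2 : ((E.filter (fun x => x - b ∉ E)).card : ℝ) ≤ η * E.card)
    (hc : θ * E.card ≤ ‖∑ x ∈ E, chi c x‖) : ‖chi c b - 1‖ ≤ 2 * η / θ := by
  have hEc : (0 : ℝ) < E.card := by exact_mod_cast hE.card_pos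
  have e1 : (chi c b - 1) * ∑ x ∈ E, chi c x = ∑ x ∈ E, chi c (x + b) - ∑ x ∈ E, chi c x := by
    simp_rw [chi_add]; rw [← Finset.sum_mul]; ring
  have e2 : ∑ x ∈ E, chi c (x + b) = ∑ x ∈ E.filter (fun x => x + b ∈ E), chi c (x + b) +
      ∑ x ∈ E.filter (fun x => x + b ∉ E), chi c (x + b) := (Finset.sum_filter_add_sum_filter_not _ _ _).symm
  have e3 : ∑ x ∈ E, chi c x = ∑ x ∈ E.filter (fun x => x - b ∈ E), chi c x +
      ∑ x ∈ E.filter (fun x => x - b ∉ E), chi c x := (Finset.sum_filter_add_sum_filter_not _ _ _).symm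
  have e4 : ∑ x ∈ E.filter (fun x => x + b ∈ E), chi c (x + b) = ∑ x ∈ E.filter (fun x => x - b ∈ E), chi c x := by
    refine Finset.sum_bij (fun x _ => x + b) ?_ ?_ ?_ ?_
    · intro x hx
      simp only [Finset.mem_filter] at hx ⊢
      simpa using ⟨hx.2, hx.1⟩
    · intro x _ y _ h
      simpa using h
    · intro y hy
      simp only [Finset.mem_filter] at hy
      exact ⟨y - b, by simpa using ⟨hy.2, hy.1⟩, by simp⟩
    · intro x _; rfl
  have n1 : ‖∑ x ∈ E.filter (fun x => x + b ∉ E), chi c (x + b)‖ ≤ η * E.card := by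
    refine (norm_sum_le _ _).trans ?_
    simp only [chi_norm]; simpa using h1
  have n2 : ‖∑ x ∈ E.filter (fun x => x - b ∉ E), chi c x‖ ≤ η * E.card := by
    refine (norm_sum_le _ _).trans ?_
    simp only [chi_norm]; simpa using h2
  have n3 : ‖chi c b - 1‖ * ‖∑ x ∈ E, chi c x‖ ≤ 2 * η * E.card := by
    rw [← norm_mul, e1, e2]
    conv_lhs => rw [e3]
    rw [e4, add_sub_add_left_eq_sub]
    refine (norm_sub_le _ _).trans ?_
    linarith
  have n4 : ‖chi c b - 1‖ * (θ * E.card) ≤ 2 * η * E.card :=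
    (mul_le_mul_of_nonneg_left hc (norm_nonneg _)).trans n3
  rw [le_div_iff₀ hθ]
  refine le_of_mul_le_mul_right ?_ hEc
  linarith

lemma prod_sub_one_le {ι : Type*} (s : Finset ι) (z : ι → ℂ) (hz : ∀ i, ‖z i‖ = 1) :
    ‖∏ i ∈ s, z i - 1‖ ≤ ∑ i ∈ s, ‖z i - 1‖ := by
  induction s using Finset.induction_on with
  | empty => simp
  | insert i s hi ih =>
    rw [Finset.prod_insert hi, Finset.sum_insert hi]
    have : z i * ∏ j ∈ s, z j - 1 = z i * (∏ j ∈ s, z j - 1) + (z i - 1) := by ring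
    rw [this]
    refine (norm_add_le _ _).trans ?_
    rw [norm_mul, hz, one_mul]
    linarith

lemma zpow_sub_one_le {z : ℂ} (hz : ‖z‖ = 1) {n : ℤ} (hn : n = 0 ∨ n = 1 ∨ n = -1) :
    ‖z ^ n - 1‖ ≤ ‖z - 1‖ := by
  have hz0 : z ≠ 0 := by rw [← norm_pos_iff, hz]; norm_num
  rcases hn with h | h | h
  · subst h; simp
  · subst h; simp
  · subst h
    rw [zpow_neg_one]
    have : z⁻¹ - 1 = -(z⁻¹ * (z - 1)) := by field_simp; ring
    rw [this, norm_neg, norm_mul, norm_inv, hz]; simp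

/-- dissociated relative to `E` -/
def Diss (E : Finset G) (θ : ℝ) (Δ : Finset (AddChar G ℂ)) : Prop :=
  ∀ c : AddChar G ℂ → ℤ, (∀ γ, c γ = 0 ∨ c γ = 1 ∨ c γ = -1) → (∀ γ ∉ Δ, c γ = 0) → c ≠ 0 →
    ‖∑ x ∈ E, chi c x‖ < θ * E.card

/-- coefficient in the Riesz product -/
noncomputable def rcoef (a : ℝ) (u : AddChar G ℂ → ℂ) (γ : AddChar G ℂ) (n : ℤ) : ℂ :=
  if n = 0 then 1 else if n = 1 then a / 2 * u γ else a / 2 * (starRingEnd ℂ) (u γ)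

/-- exponents allowed -/
noncomputable def rset (Δ : Finset (AddChar G ℂ)) (γ : AddChar G ℂ) : Finset ℤ :=
  if γ ∈ Δ then {0, 1, -1} else {0}

lemma riesz_bound {E : Finset G} {θ a : ℝ} {Δ : Finset (AddChar G ℂ)} (ha0 : 0 ≤ a) (ha : a ≤ 1) (hθ : 0 ≤ θ)
    (hΔ : Diss E θ Δ) (u : AddChar G ℂ → ℂ) (hu : ∀ γ, ‖u γ‖ = 1) :
    ∑ x ∈ E, ∏ γ ∈ Δ, (1 + a * (u γ * γ x).re) ≤ E.card * (1 + θ * 2 ^ Δ.card) := by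
  have h1 : ∀ x : G, ((∏ γ ∈ Δ, (1 + a * (u γ * γ x).re) : ℝ) : ℂ) =
      ∑ c ∈ Fintype.piFinset (rset Δ), (∏ γ, rcoef a u γ (c γ)) * chi c x := by
    intro x
    have : ∀ γ, ∑ n ∈ rset Δ γ, rcoef a u γ n * (γ x) ^ n =
        if γ ∈ Δ then ((1 + a * (u γ * γ x).re : ℝ) : ℂ) else 1 := by
      intro γ
      unfold rset
      split_ifs with h
      · rw [Finset.sum_insert (by decide), Finset.sum_insert (by decide), Finset.sum_singleton]
        simp only [rcoef]
        norm_num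
        have hinv : (γ x)⁻¹ = (starRingEnd ℂ) (γ x) := by
          rw [← AddChar.map_neg_eq_conj, AddChar.map_neg_eq_inv]
        have hre : ((u γ * γ x).re : ℂ) = (u γ * γ x + (starRingEnd ℂ) (u γ * γ x)) / 2 := by
          rw [Complex.add_conj]; push_cast; ring
        have hre2 : ((u γ).re * (γ x).re - (u γ).im * (γ x).im : ℂ) = ((u γ * γ x).re : ℂ) := by
          simp [Complex.mul_re]
        rw [hinv, hre2, hre, map_mul]
        ring
      · simp [rcoef]
    simp only [chi, ← Finset.prod_mul_distrib]
    rw [← Finset.prod_univ_sum (rset Δ) (fun γ n => rcoef a u γ n * (γ x) ^ n)]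
    simp_rw [this]
    rw [Finset.prod_ite_mem, Finset.univ_inter]
    push_cast
    rfl
  have h2 : ((∑ x ∈ E, ∏ γ ∈ Δ, (1 + a * (u γ * γ x).re) : ℝ) : ℂ) =
      ∑ c ∈ Fintype.piFinset (rset Δ), (∏ γ, rcoef a u γ (c γ)) * ∑ x ∈ E, chi c x := by
    rw [Complex.ofReal_sum]
    simp_rw [h1]
    rw [Finset.sum_comm]
    simp_rw [Finset.mul_sum]
  have hco : ∀ γ n, ‖rcoef a u γ n‖ ≤ if n = 0 then 1 else a / 2 := by
    intro γ n
    unfold rcoef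
    have : ‖(a / 2 : ℂ)‖ = a / 2 := by
      rw [norm_div, Complex.norm_real, Real.norm_of_nonneg ha0]; norm_num
    split_ifs
    · simp
    · rw [norm_mul, hu, this, mul_one]
    · rw [norm_mul, RCLike.norm_conj, hu, this, mul_one]
  refine (le_abs_self _).trans ?_
  rw [← Real.norm_eq_abs, ← Complex.norm_real, h2]
  refine (norm_sum_le _ _).trans ?_
  have h3 : ∀ c ∈ Fintype.piFinset (rset Δ), ‖(∏ γ, rcoef a u γ (c γ)) * ∑ x ∈ E, chi c x‖ ≤
      (if c = 0 then (E.card : ℝ) else 0) + (∏ γ, (if c γ = 0 then 1 else a / 2)) * (θ * E.card) := by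
    intro c hc
    rw [Fintype.mem_piFinset] at hc
    have hp0 : (0 : ℝ) ≤ ∏ γ, (if c γ = 0 then 1 else a / 2) :=
      Finset.prod_nonneg fun γ _ => by split_ifs <;> positivity
    rw [norm_mul, norm_prod]
    by_cases h0 : c = 0
    · subst h0
      simp only [if_true, Pi.zero_apply, Finset.prod_const_one, one_mul]
      have : ∏ γ : AddChar G ℂ, ‖rcoef a u γ 0‖ = 1 := by simp [rcoef]
      rw [this, one_mul]
      have h4 : ‖∑ x ∈ E, chi 0 x‖ ≤ (E.card : ℝ) := by
        refine (norm_sum_le _ _).trans ?_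
        simp [chi_norm]
      have : 0 ≤ θ * E.card := by positivity
      linarith
    · rw [if_neg h0, zero_add]
      refine mul_le_mul (Finset.prod_le_prod (fun _ _ => norm_nonneg _) fun γ _ => hco γ _) ?_ (norm_nonneg _) hp0
      refine (hΔ c ?_ ?_ h0).le
      · intro γ
        have := hc γ
        unfold rset at this
        split_ifs at this
        · simpa using this
        · left; simpa using this
      · intro γ hγ
        have := hc γ
        unfold rset at this
        rw [if_neg hγ] at this
        simpa using this
  refine (Finset.sum_le_sum h3).trans ?_
  rw [Finset.sum_add_distrib, ← Finset.sum_mul, ← Finset.prod_univ_sum (rset Δ) (fun _ n => if n = 0 then (1 : ℝ) else a / 2)]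
  have h5 : ∑ c ∈ Fintype.piFinset (rset Δ), (if c = 0 then (E.card : ℝ) else 0) ≤ E.card := by
    rw [Finset.sum_ite_eq']
    split_ifs
    · rfl
    · positivity
  have h6 : ∏ γ : AddChar G ℂ, ∑ n ∈ rset Δ γ, (if n = 0 then (1 : ℝ) else a / 2) ≤ 2 ^ Δ.card := by
    have : ∀ γ, ∑ n ∈ rset Δ γ, (if n = 0 then (1 : ℝ) else a / 2) = if γ ∈ Δ then 1 + a else 1 := by
      intro γ
      unfold rset
      split_ifs with h
      · rw [Finset.sum_insert (by decide), Finset.sum_insert (by decide), Finset.sum_singleton]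
        norm_num
      · simp
    simp_rw [this]
    rw [Finset.prod_ite_mem, Finset.univ_inter, Finset.prod_const]
    exact pow_le_pow_left₀ (by linarith) (by linarith) _
  have h7 : (∏ γ : AddChar G ℂ, ∑ n ∈ rset Δ γ, (if n = 0 then (1 : ℝ) else a / 2)) * (θ * E.card) ≤
      2 ^ Δ.card * (θ * E.card) := mul_le_mul_of_nonneg_right h6 (by positivity)
  linarith

lemma diss_bound {T E : Finset G} {M : ℕ} (hTE : T ⊆ E) (hT0 : T.Nonempty) (hT : (E.card : ℝ) ≤ 2 ^ M * T.card)
    {Δ : Finset (AddChar G ℂ)} {θ : ℝ} (hθ : 0 ≤ θ) (hd : Diss E θ Δ) (hθ1 : θ * 2 ^ Δ.card ≤ 1)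
    (hspec : ∀ γ ∈ Δ, 1 / 2 * (T.card : ℝ) ≤ ‖ch T γ‖) : Δ.card ≤ 16 * (M + 1) := by
  have hTc : (0 : ℝ) < T.card := by exact_mod_cast hT0.card_pos
  have hu : ∀ γ : AddChar G ℂ, ∃ u : ℂ, ‖u‖ = 1 ∧ u * ch T γ = (‖ch T γ‖ : ℂ) := by
    intro γ
    by_cases h : ch T γ = 0
    · exact ⟨1, by simp, by simp [h]⟩
    · refine ⟨(starRingEnd ℂ) (ch T γ) / ‖ch T γ‖, ?_, ?_⟩
      · rw [norm_div, RCLike.norm_conj]; simp [h]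
      · have h2 : (‖ch T γ‖ : ℂ) ≠ 0 := by simpa using h
        rw [div_mul_eq_mul_div, mul_comm, mul_conj_norm]
        push_cast
        field_simp
  choose u hu1 hu2 using hu
  set r : ℝ := (Δ.card : ℝ) with hr
  set Y : G → ℝ := fun x => ∑ γ ∈ Δ, (u γ * γ x).re with hY
  have hYsum : r / 2 * T.card ≤ ∑ x ∈ T, Y x := by
    rw [hY, Finset.sum_comm]
    calc r / 2 * T.card = ∑ γ ∈ Δ, 1 / 2 * (T.card : ℝ) := by rw [Finset.sum_const, nsmul_eq_mul]; ring
      _ ≤ ∑ γ ∈ Δ, ‖ch T γ‖ := Finset.sum_le_sum hspec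
      _ = _ := by
        refine Finset.sum_congr rfl fun γ _ => ?_
        rw [← Complex.re_sum, ← Finset.mul_sum]
        change _ = (u γ * ch T γ).re
        rw [hu2]; simp
  have hlow : T.card * Real.exp (r / 8) ≤ ∑ x ∈ T, Real.exp (1 / 4 * Y x) := by
    have : ∀ x ∈ T, Real.exp (r / 8) * (1 + (1 / 4 * Y x - r / 8)) ≤ Real.exp (1 / 4 * Y x) := by
      intro x _
      have h1 := Real.add_one_le_exp (1 / 4 * Y x - r / 8)
      calc _ ≤ Real.exp (r / 8) * Real.exp (1 / 4 * Y x - r / 8) := by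
            gcongr; linarith
        _ = _ := by rw [← Real.exp_add]; congr 1; ring
    refine le_trans ?_ (Finset.sum_le_sum this)
    rw [← Finset.mul_sum, Finset.sum_add_distrib, Finset.sum_sub_distrib, ← Finset.mul_sum]
    simp only [Finset.sum_const, nsmul_eq_mul, mul_one]
    rw [mul_comm]
    refine mul_le_mul_of_nonneg_left ?_ (Real.exp_pos _).le
    linarith
  have hup : ∀ x, Real.exp (1 / 4 * Y x) ≤ (17 / 16) ^ Δ.card * ∏ γ ∈ Δ, (1 + (4 / 17 : ℝ) * (u γ * γ x).re) := by
    intro x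
    rw [hY, Finset.mul_sum, Real.exp_sum, ← Finset.prod_const, ← Finset.prod_mul_distrib]
    refine Finset.prod_le_prod (fun _ _ => (Real.exp_pos _).le) fun γ _ => ?_
    have hn : |(u γ * γ x).re| ≤ 1 := by
      refine (Complex.abs_re_le_norm _).trans ?_
      rw [norm_mul, hu1, AddChar.norm_apply, one_mul]
    set y := (u γ * γ x).re
    have h4 : |1 / 4 * y| ≤ 1 / 4 := by rw [abs_mul]; norm_num; linarith
    have h1 := Real.abs_exp_sub_one_sub_id_le (x := 1 / 4 * y) (by linarith)
    have h2 := le_abs_self (Real.exp (1 / 4 * y) - 1 - 1 / 4 * y)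
    have h3 : (1 / 4 * y) ^ 2 ≤ (1 / 4) ^ 2 := by
      rw [← sq_abs]; exact pow_le_pow_left₀ (abs_nonneg _) h4 2
    linarith
  have hE2 : ∑ x ∈ E, ∏ γ ∈ Δ, (1 + (4 / 17 : ℝ) * (u γ * γ x).re) ≤ E.card * 2 := by
    refine (riesz_bound (by norm_num) (by norm_num) hθ hd u hu1).trans ?_
    gcongr
    linarith
  have h8 : ∑ x ∈ T, Real.exp (1 / 4 * Y x) ≤ (17 / 16) ^ Δ.card * (E.card * 2) := by
    calc _ ≤ ∑ x ∈ E, Real.exp (1 / 4 * Y x) :=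
          Finset.sum_le_sum_of_subset_of_nonneg hTE fun _ _ _ => (Real.exp_pos _).le
      _ ≤ ∑ x ∈ E, (17 / 16) ^ Δ.card * ∏ γ ∈ Δ, (1 + (4 / 17 : ℝ) * (u γ * γ x).re) :=
          Finset.sum_le_sum fun x _ => hup x
      _ ≤ _ := by rw [← Finset.mul_sum]; gcongr
  have h9 : (17 / 16 : ℝ) ^ Δ.card ≤ Real.exp (r / 16) := by
    have := Real.add_one_le_exp (1 / 16 : ℝ)
    calc (17 / 16 : ℝ) ^ Δ.card ≤ (Real.exp (1 / 16)) ^ Δ.card :=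
          pow_le_pow_left₀ (by norm_num) (by linarith) _
      _ = _ := by rw [← Real.exp_nat_mul]; congr 1; rw [hr]; ring
  have h10 : T.card * Real.exp (r / 8) ≤ Real.exp (r / 16) * (2 ^ M * T.card * 2) := by
    refine hlow.trans (h8.trans ?_)
    gcongr
  have h11 : Real.exp (r / 8) = Real.exp (r / 16) * Real.exp (r / 16) := by
    rw [← Real.exp_add]; congr 1; ring
  have h12 : Real.exp (r / 16) ≤ 2 ^ (M + 1) := by
    rw [h11] at h10
    have hp : 0 < T.card * Real.exp (r / 16) := by positivity
    refine le_of_mul_le_mul_left ?_ hp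
    rw [pow_succ]
    linarith
  have h13 : (2 : ℝ) ^ (M + 1) ≤ Real.exp (M + 1) := by
    have := Real.add_one_le_exp (1 : ℝ)
    calc (2 : ℝ) ^ (M + 1) ≤ (Real.exp 1) ^ (M + 1) := pow_le_pow_left₀ (by norm_num) (by linarith) _
      _ = _ := by rw [← Real.exp_nat_mul]; congr 1; push_cast; ring
  have h14 := Real.exp_le_exp.1 (h12.trans h13)
  have h15 : (Δ.card : ℝ) ≤ 16 * (M + 1) := by linarith
  exact_mod_cast h15

lemma chang {T E : Finset G} {M : ℕ} (hTE : T ⊆ E) (hT0 : T.Nonempty) (hT : (E.card : ℝ) ≤ 2 ^ M * T.card)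
    {r0 : ℕ} (hr0 : r0 = 16 * (M + 1)) :
    ∃ Δ : Finset (AddChar G ℂ), Δ.card ≤ r0 ∧ ∀ (ρ η : ℝ) (b : G), 0 ≤ ρ → 0 ≤ η → b ∈ bohr Δ ρ →
      ((E.filter (fun x => x + b ∉ E)).card : ℝ) ≤ η * E.card →
      ((E.filter (fun x => x - b ∉ E)).card : ℝ) ≤ η * E.card →
      ∀ γ : AddChar G ℂ, 1 / 2 * (T.card : ℝ) ≤ ‖ch T γ‖ → ‖γ b - 1‖ ≤ 2 * η * 2 ^ (r0 + 1) + r0 * ρ := by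
  set θ : ℝ := (1 / 2) ^ (r0 + 1) with hθ
  have hθ0 : 0 < θ := by positivity
  set S := (Finset.univ : Finset (Finset (AddChar G ℂ))).filter
    (fun Δ => (∀ γ ∈ Δ, 1 / 2 * (T.card : ℝ) ≤ ‖ch T γ‖) ∧ Diss E θ Δ ∧ Δ.card ≤ r0 + 1) with hS
  have hSne : S.Nonempty := by
    refine ⟨∅, ?_⟩
    simp only [hS, Finset.mem_filter, Finset.mem_univ, true_and, Finset.card_empty, Finset.notMem_empty,
      false_implies, implies_true, zero_le, and_true]
    intro c _ h1 h2
    exact absurd (funext fun γ => h1 γ (by simp)) h2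
  obtain ⟨Δ, hΔS, hmax⟩ := Finset.exists_max_image S Finset.card hSne
  simp only [hS, Finset.mem_filter, Finset.mem_univ, true_and] at hΔS hmax
  obtain ⟨hspec, hdiss, hcard⟩ := hΔS
  have hle : Δ.card ≤ r0 := by
    rw [hr0]
    refine diss_bound hTE hT0 hT hθ0.le hdiss ?_ hspec
    calc θ * 2 ^ Δ.card ≤ θ * 2 ^ (r0 + 1) := by gcongr; norm_num
      _ = 1 := by rw [hθ, ← mul_pow]; norm_num
  refine ⟨Δ, hle, ?_⟩
  intro ρ η b hρ hη hb hE1 hE2 γ hγ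
  rw [mem_bohr] at hb
  have hEne : E.Nonempty := hT0.mono hTE
  have hr0' : (1 : ℝ) ≤ r0 := by
    have : 1 ≤ r0 := by omega
    exact_mod_cast this
  by_cases hγΔ : γ ∈ Δ
  · have := hb γ hγΔ
    have h1 : 0 ≤ 2 * η * 2 ^ (r0 + 1) := by positivity
    nlinarith
  have hnd : ¬ Diss E θ (insert γ Δ) := by
    intro h
    have := hmax (insert γ Δ) ⟨?_, h, ?_⟩
    · rw [Finset.card_insert_of_notMem hγΔ] at this; omega
    · intro γ' h'
      rcases Finset.mem_insert.1 h' with h' | h'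
      · rw [h']; exact hγ
      · exact hspec _ h'
    · rw [Finset.card_insert_of_notMem hγΔ]; omega
  unfold Diss at hnd
  push Not at hnd
  obtain ⟨c, hc1, hc2, hc0, hc3⟩ := hnd
  have hcγ : c γ ≠ 0 := by
    intro h
    have := hdiss c hc1 (fun γ' h' => by
      by_cases hh : γ' = γ
      · rw [hh]; exact h
      · exact hc2 γ' (by simp [hh, h'])) hc0
    linarith
  have hclose := chi_close c E hθ0 hEne b hE1 hE2 hc3
  have e1 : chi c b = (γ b) ^ (c γ) * ∏ γ' ∈ Δ, (γ' b) ^ (c γ') := by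
    unfold chi
    rw [← Finset.prod_subset (Finset.subset_univ (insert γ Δ)), Finset.prod_insert hγΔ]
    intro γ' _ h'
    rw [hc2 γ' h', zpow_zero]
  set P := ∏ γ' ∈ Δ, (γ' b) ^ (c γ') with hP
  have hP1 : ‖P - 1‖ ≤ r0 * ρ := by
    refine (prod_sub_one_le _ _ fun γ' => by rw [norm_zpow, AddChar.norm_apply, one_zpow]).trans ?_
    calc _ ≤ ∑ γ' ∈ Δ, ρ := Finset.sum_le_sum fun γ' h' =>
          (zpow_sub_one_le (AddChar.norm_apply _ _) (hc1 γ')).trans (hb γ' h')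
      _ = Δ.card * ρ := by simp
      _ ≤ _ := by gcongr
  have hPn : ‖P‖ = 1 := by
    rw [hP, norm_prod]; simp [AddChar.norm_apply]
  have hz : ‖(γ b) ^ (c γ) - 1‖ ≤ ‖chi c b - 1‖ + ‖P - 1‖ := by
    have : ((γ b) ^ (c γ) - 1) * P = (chi c b - 1) - (P - 1) := by rw [e1]; ring
    calc ‖(γ b) ^ (c γ) - 1‖ = ‖((γ b) ^ (c γ) - 1) * P‖ := by rw [norm_mul, hPn, mul_one]
      _ ≤ _ := by rw [this]; exact norm_sub_le _ _
  have hlast : ‖γ b - 1‖ ≤ ‖(γ b) ^ (c γ) - 1‖ := by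
    have hn : ‖(γ b) ^ (c γ)‖ = 1 := by rw [norm_zpow, AddChar.norm_apply, one_zpow]
    have h1 := zpow_sub_one_le hn (hc1 γ)
    rw [← zpow_mul] at h1
    have h2 : c γ * c γ = 1 := by
      rcases hc1 γ with h | h | h
      · exact absurd h hcγ
      · rw [h]; norm_num
      · rw [h]; norm_num
    rwa [h2, zpow_one] at h1
  have h5 : 2 * η / θ = 2 * η * 2 ^ (r0 + 1) := by
    rw [hθ, one_div, inv_pow, div_inv_eq_mul]
  rw [h5] at hclose
  linarith

end part5


/-- parameters -/
def prP (l : ℕ) : ℕ := 2 * l + 40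
def prS (l : ℕ) : ℕ := 8 * prP l * (2 * l + 1)
def prK (l : ℕ) : ℕ := l + 10
def prM (l : ℕ) : ℕ := 4 * (4000 * prK l) ^ 2 * (prS l + prK l + 16)
def prMM (l : ℕ) : ℕ := 1 + prM l * (prS l + 1)
def prR (l : ℕ) : ℕ := 16 * (prMM l + 1)

section part6
variable {G : Type*} [AddCommGroup G] [Fintype G]

lemma exp_param (l : ℕ) {δ : ℝ} (hδ : δ = 1 / (4000 * prK l)) :
    Real.exp (-(prM l * δ ^ 2 / 4)) * (32000 * prK l * 2 ^ (prS l)) ≤ 1 := by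
  have hk : (0 : ℝ) < prK l := by unfold prK; positivity
  have h1 : (prM l : ℝ) * δ ^ 2 / 4 = prS l + prK l + 16 := by
    rw [hδ, prM]; push_cast; field_simp; 
  have h2 : ∀ n : ℕ, (2 : ℝ) ^ n ≤ Real.exp n := by
    intro n
    have := Real.add_one_le_exp (1 : ℝ)
    calc (2 : ℝ) ^ n ≤ (Real.exp 1) ^ n := pow_le_pow_left₀ (by norm_num) (by linarith) _
      _ = _ := by rw [← Real.exp_nat_mul]; congr 1; ring
  rw [h1, Real.exp_neg, inv_mul_le_iff₀ (Real.exp_pos _), mul_one, Real.exp_add, Real.exp_add]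
  have h3 : (prK l : ℝ) ≤ Real.exp (prK l) := by
    have := Real.add_one_le_exp (prK l : ℝ); linarith
  have h4 : (32000 : ℝ) ≤ Real.exp 16 := by
    have := h2 16; norm_num at this; linarith
  calc (32000 : ℝ) * prK l * 2 ^ (prS l) ≤ Real.exp 16 * Real.exp (prK l) * Real.exp (prS l) := by
        gcongr; exact h2 _
    _ = _ := by ring

lemma core {A B E E3 H W : Finset G} {w : G → ℝ} {a η : ℝ} {l : ℕ} (hAB : A ⊆ B)
    (hB : ∀ x ∈ B, -x ∈ B) (hE0 : E.Nonempty) (hE : ∀ x ∈ E, -x ∈ E)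
    (ha1 : a ≤ 1) (hal : (1 / 2 : ℝ) ^ l ≤ a) (hA : (A.card : ℝ) = a * B.card) (hB0 : 0 < B.card)
    (hinv : ∀ u ∈ E, ∀ v ∈ E, ((B.filter (fun x => x - (u - v) ∉ B)).card : ℝ) ≤ η * B.card)
    (hη : η ≤ a / 256) (hw : ∀ t, w t = 0 ∨ w t = 1)
    (hcount : ∑ u ∈ E, ∑ v ∈ E, w (u - v) * cnv (ind A) (ind A) (u - v) ≤
      1 / 2 * a ^ 2 * B.card * ∑ u ∈ E, ∑ v ∈ E, w (u - v))
    (hws : (1 / 2 : ℝ) ^ l * (E.card : ℝ) ^ 2 ≤ ∑ u ∈ E, ∑ v ∈ E, w (u - v))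
    (hH : ∀ x ∈ A, ∀ u ∈ E, x - u ∈ H) (hHc : (H.card : ℝ) ≤ 2 * B.card)
    (hE3 : E3.Nonempty) (hW0 : ∀ u ∈ E, ∀ t ∈ E3, u - t ∈ W) (hWc : (W.card : ℝ) ≤ 2 * E.card)
    (hW : ∀ j ≤ prK l, ∀ t t' : Fin j → G, (∀ i, t i ∈ E3) → (∀ i, t' i ∈ E3) → ∀ x ∈ E,
      x + (∑ i, t' i - ∑ i, t i) ∈ W) :
    ∃ Δ : Finset (AddChar G ℂ), Δ.card ≤ prR l ∧ ∀ B4 : Finset G,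
      (∀ b ∈ B4, b ∈ bohr Δ (1 / (2000 * prR l)) ∧
        ((E3.filter (fun x => x + b ∉ E3)).card : ℝ) ≤ (1 / 2) ^ (prR l + 20) * E3.card ∧
        ((E3.filter (fun x => x - b ∉ E3)).card : ℝ) ≤ (1 / 2) ^ (prR l + 20) * E3.card) →
      ∃ z, 101 / 100 * a * B4.card ≤ (B4.filter (fun b => z + b ∈ A)).card := by
  have ha : 0 < a := lt_of_lt_of_le (by positivity) hal
  have hb0 : (0 : ℝ) < B.card := by exact_mod_cast hB0
  have hEc : (0 : ℝ) < E.card := by exact_mod_cast hE0.card_pos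
  have hE3c : (0 : ℝ) < E3.card := by exact_mod_cast hE3.card_pos
  have hp20 : 20 ≤ prP l := by unfold prP; omega
  have hws' : (1 / 2 : ℝ) ^ (prP l) * (E.card : ℝ) ^ 2 ≤ ∑ u ∈ E, ∑ v ∈ E, w (u - v) := by
    refine le_trans ?_ hws
    gcongr ?_ * _
    exact pow_le_pow_of_le_one (by norm_num) (by norm_num) (by unfold prP; omega)
  have hV := part1 hAB hB hE0 hE ha ha1 hA hB0 hinv hη hw (by unfold prP; exact ⟨l + 20, by ring⟩)
    (by omega : 16 ≤ prP l) hcount hws'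
  obtain ⟨D, hDE, hDc, hbad⟩ := sift hH hHc ha hb0 hE0 hp20 hV
  have hσ : (1 / 2 : ℝ) ^ (prS l) ≤ (a ^ 2 / 2) ^ (8 * prP l) := by
    have : prS l = (2 * l + 1) * (8 * prP l) := by unfold prS; ring
    rw [this, pow_mul]
    refine pow_le_pow_left₀ (by positivity) ?_ _
    have h2 : ((1 / 2 : ℝ) ^ l) ^ 2 ≤ a ^ 2 := pow_le_pow_left₀ (by positivity) hal 2
    have e : (1 / 2 : ℝ) ^ (2 * l + 1) = ((1 / 2 : ℝ) ^ l) ^ 2 / 2 := by rw [pow_succ, pow_mul']; ring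
    rw [e]; linarith
  have hDs : (E.card : ℝ) ≤ 2 ^ (prS l) * D.card := by
    have h1 : (1 / 2 : ℝ) ^ (prS l) * E.card ≤ D.card := le_trans (by gcongr) hDc
    calc (E.card : ℝ) = 2 ^ (prS l) * ((1 / 2 : ℝ) ^ (prS l) * E.card) := by
          rw [← mul_assoc, ← mul_pow]; norm_num
      _ ≤ _ := by gcongr
  have hDne : D.Nonempty := by
    rw [← Finset.card_pos]
    have : (0 : ℝ) < D.card := lt_of_lt_of_le (by positivity) hDc
    exact_mod_cast this
  have hDc0 : (0 : ℝ) < D.card := by exact_mod_cast hDne.card_pos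
  set R := cor (ind A) (ind A) with hR
  set f : G → ℝ := fun t => if R t < 65 / 64 * (a ^ 2 * B.card) then 0 else 1 with hf
  have hf01 : ∀ x, 0 ≤ f x ∧ f x ≤ 1 := by
    intro x; simp only [hf]; split_ifs <;> norm_num
  set δ : ℝ := 1 / (4000 * prK l) with hδ
  have hk1 : (1 : ℝ) ≤ prK l := by unfold prK; push_cast; linarith [(Nat.cast_nonneg l : (0 : ℝ) ≤ l)]
  have hδ0 : 0 < δ := by positivity
  have hδ1 : δ ≤ 1 := by
    rw [hδ, div_le_one (by positivity)]; linarith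
  have hm0 : 0 < prM l := by
    unfold prM prK; positivity
  obtain ⟨T, hTE, hTc, hT⟩ := croot_sisask hf01 hDne hE3 (fun u hu t ht => hW0 u (hDE hu) t ht) hδ0 hδ1 hm0
  have hWpos : (0 : ℝ) < W.card := by
    obtain ⟨u, hu⟩ := hE0
    obtain ⟨t, ht⟩ := hE3
    exact_mod_cast Finset.card_pos.2 ⟨_, hW0 u hu t ht⟩
  have hWD : (W.card : ℝ) ≤ 2 ^ (prS l + 1) * D.card := by
    rw [pow_succ]; linarith
  have hTE3 : (E3.card : ℝ) ≤ 2 ^ (prMM l) * T.card := by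
    have h1 : (1 / 2 : ℝ) ^ (prS l + 1) ≤ D.card / W.card := by
      rw [le_div_iff₀ hWpos]
      calc (1 / 2 : ℝ) ^ (prS l + 1) * W.card ≤ (1 / 2 : ℝ) ^ (prS l + 1) * (2 ^ (prS l + 1) * D.card) := by gcongr
        _ = D.card := by rw [← mul_assoc, ← mul_pow]; norm_num
    have h2 : 1 / 2 * ((1 / 2 : ℝ) ^ (prS l + 1)) ^ (prM l) * E3.card ≤ T.card := le_trans (by gcongr) hTc
    have h3 : 1 / 2 * ((1 / 2 : ℝ) ^ (prS l + 1)) ^ (prM l) = (1 / 2) ^ (prMM l) := by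
      rw [← pow_mul, prMM, pow_add, mul_comm (prM l)]; ring
    rw [h3] at h2
    calc (E3.card : ℝ) = 2 ^ (prMM l) * ((1 / 2 : ℝ) ^ (prMM l) * E3.card) := by
          rw [← mul_assoc, ← mul_pow]; norm_num
      _ ≤ _ := by gcongr
  have hTne : T.Nonempty := by
    rw [← Finset.card_pos]
    have : (0 : ℝ) < T.card := lt_of_lt_of_le (by positivity) hTc
    exact_mod_cast this
  have hFb := avgF_bounds hf01 hDne
  have hchain := cs_chain hFb hT hδ0 (k := prK l) (D := D)
    (fun j hj t t' ht ht' x hx => hW j hj t t' (fun i => hTE (ht i)) (fun i => hTE (ht' i)) x (hDE hx))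
    (prK l) le_rfl
  -- error bound
  have herr : (prK l : ℝ) * (2 * δ * D.card + 8 * Real.exp (-(prM l * δ ^ 2 / 4)) * W.card) ≤ D.card / 1000 := by
    have h1 := exp_param l hδ
    have h2 : (prK l : ℝ) * (2 * δ * D.card) = D.card / 2000 := by
      rw [hδ]; field_simp; ring
    have h3 : (prK l : ℝ) * (8 * Real.exp (-(prM l * δ ^ 2 / 4)) * W.card) ≤ D.card / 2000 := by
      calc _ ≤ (prK l : ℝ) * (8 * Real.exp (-(prM l * δ ^ 2 / 4)) * (2 ^ (prS l + 1) * D.card)) := by gcongr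
        _ = (Real.exp (-(prM l * δ ^ 2 / 4)) * (32000 * prK l * 2 ^ (prS l))) * (D.card / 2000) := by
          rw [pow_succ]; ring
        _ ≤ 1 * (D.card / 2000) := by gcongr
        _ = _ := by ring
    rw [mul_add, h2]; linarith
  have hFD : (999 / 1000 : ℝ) * D.card ≤ ∑ x ∈ D, avgF f D x := by
    have h1 : ∑ x ∈ D, avgF f D x = (D.card : ℝ)⁻¹ * ∑ u ∈ D, ∑ v ∈ D, f (u - v) := by
      unfold avgF
      rw [← Finset.mul_sum, Finset.sum_comm]
    have h2 : ∑ u ∈ D, ∑ v ∈ D, f (u - v) = (D.card : ℝ) ^ 2 -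
        ∑ u ∈ D, ∑ v ∈ D, (if R (u - v) < 65 / 64 * (a ^ 2 * B.card) then (1 : ℝ) else 0) := by
      have : (D.card : ℝ) ^ 2 = ∑ u ∈ D, ∑ v ∈ D, (1 : ℝ) := by simp; ring
      rw [this, ← Finset.sum_sub_distrib]
      refine Finset.sum_congr rfl fun u _ => ?_
      rw [← Finset.sum_sub_distrib]
      refine Finset.sum_congr rfl fun v _ => ?_
      simp only [hf]; split_ifs <;> norm_num
    rw [h1, h2, le_inv_mul_iff₀ hDc0]
    linarith
  have hX : (65 / 64 * (998 / 1000) * (a ^ 2 * B.card)) * (idx D T (prK l)).card ≤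
      ∑ i ∈ idx D T (prK l), R (idxp i) := by
    have h1 : ∀ t t' : Fin (prK l) → G, (∀ i, t i ∈ T) → (∀ i, t' i ∈ T) →
        998 / 1000 * (D.card : ℝ) ^ 2 ≤ ∑ u ∈ D, ∑ x ∈ D, f (u - (x + (∑ i, t' i - ∑ i, t i))) := by
      intro t t' ht ht'
      have h2 := hchain t t' ht ht'
      have h3 : ∑ x ∈ D, avgF f D (x + (∑ i, t' i - ∑ i, t i)) =
          (D.card : ℝ)⁻¹ * ∑ u ∈ D, ∑ x ∈ D, f (u - (x + (∑ i, t' i - ∑ i, t i))) := by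
        unfold avgF
        rw [← Finset.mul_sum, Finset.sum_comm]
      rw [h3] at h2
      have h4 : (998 / 1000 : ℝ) * D.card ≤
          (D.card : ℝ)⁻¹ * ∑ u ∈ D, ∑ x ∈ D, f (u - (x + (∑ i, t' i - ∑ i, t i))) := by linarith
      rw [le_inv_mul_iff₀ hDc0] at h4
      linarith
    have h5 : ∑ i ∈ idx D T (prK l), 65 / 64 * (a ^ 2 * B.card) * f (idxp i) ≤ ∑ i ∈ idx D T (prK l), R (idxp i) := by
      refine Finset.sum_le_sum fun i _ => ?_
      simp only [hf]
      split_ifs with h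
      · rw [mul_zero]
        exact Finset.sum_nonneg fun x _ => mul_nonneg (ind_nonneg _ _) (ind_nonneg _ _)
      · rw [mul_one]; exact not_lt.1 h
    refine le_trans ?_ h5
    rw [← Finset.mul_sum]
    have h6 : 998 / 1000 * ((idx D T (prK l)).card : ℝ) ≤ ∑ i ∈ idx D T (prK l), f (idxp i) := by
      have h7 : ∑ i ∈ idx D T (prK l), f (idxp i) =
          ∑ q ∈ (Fintype.piFinset (fun _ : Fin (prK l) => T)) ×ˢ (Fintype.piFinset (fun _ : Fin (prK l) => T)),
            ∑ u ∈ D, ∑ x ∈ D, f (u - (x + (∑ i, q.2 i - ∑ i, q.1 i))) := by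
        rw [idx, Finset.sum_product_right]
        refine Finset.sum_congr rfl fun q _ => ?_
        rw [Finset.sum_product]
        rfl
      have h8 : ((idx D T (prK l)).card : ℝ) = ∑ q ∈ (Fintype.piFinset (fun _ : Fin (prK l) => T)) ×ˢ
          (Fintype.piFinset (fun _ : Fin (prK l) => T)), (D.card : ℝ) ^ 2 := by
        rw [Finset.sum_const, idx, Finset.card_product (D ×ˢ D), Finset.card_product D D, nsmul_eq_mul]
        push_cast
        ring
      rw [h7, h8, Finset.mul_sum]
      refine Finset.sum_le_sum fun q hq => ?_
      rw [Finset.mem_product, Fintype.mem_piFinset, Fintype.mem_piFinset] at hq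
      exact h1 q.1 q.2 hq.1 hq.2
    have h9 : (0 : ℝ) ≤ 65 / 64 * (a ^ 2 * B.card) := by positivity
    have := mul_le_mul_of_nonneg_left h6 h9
    linarith
  obtain ⟨Δ, hΔc, hΔ⟩ := chang hTE hTne hTE3 (r0 := prR l) rfl
  refine ⟨Δ, hΔc, fun B4 hB4 => ?_⟩
  have hr0 : (0 : ℝ) < prR l := Nat.cast_pos.2 (by unfold prR; omega)
  generalize prR l = r0 at *
  obtain ⟨z, hz⟩ := fourier_conclude (A := A) (B4 := B4) (k := prK l) (δ := 1 / 1000) (by norm_num) (by norm_num)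
    hDne hTne (fun γ hγ b hb => by
      obtain ⟨b1, b2, b3⟩ := hB4 b hb
      have := hΔ _ _ b (by positivity) (by positivity) b1 b2 b3 γ hγ
      refine this.trans ?_
      have e1 : 2 * (1 / 2 : ℝ) ^ (r0 + 20) * 2 ^ (r0 + 1) = 1 / 2 ^ 18 := by
        have : 2 * (1 / 2 : ℝ) ^ (r0 + 20) * 2 ^ (r0 + 1) =
          ((1 / 2 : ℝ) ^ r0 * 2 ^ r0) * (4 * (1 / 2) ^ 20) := by
            rw [pow_add, pow_succ]; ring
        rw [this, ← mul_pow]; norm_num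
      have e2 : (r0 : ℝ) * (1 / (2000 * r0)) = 1 / 2000 := by field_simp
      rw [e1, e2]; norm_num) hX
  refine ⟨z, ?_⟩
  have hAc : (0 : ℝ) < A.card := by rw [hA]; positivity
  refine le_of_mul_le_mul_left (le_trans ?_ hz) hAc
  have h4k : 2 * (1 / 4 : ℝ) ^ (prK l) ≤ a / 1000 := by
    have : (1 / 4 : ℝ) ^ (prK l) ≤ a * (1 / 2) ^ 11 := by
      unfold prK
      calc (1 / 4 : ℝ) ^ (l + 10) = (1 / 4) ^ l * (1 / 4) ^ 10 := by rw [pow_add]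
        _ ≤ (1 / 2) ^ l * (1 / 2) ^ 11 := by gcongr <;> norm_num
        _ ≤ _ := by gcongr
    norm_num at this ⊢
    linarith
  have h5 : 101 / 100 * a * A.card ≤ (1 - 1 / 1000) * (65 / 64 * (998 / 1000) * (a ^ 2 * B.card)) -
      2 * (1 / 4) ^ (prK l) * A.card := by
    have h6 : 2 * (1 / 4) ^ (prK l) * A.card ≤ a / 1000 * A.card := by gcongr
    have h7 : a ^ 2 * B.card = a * A.card := by rw [hA]; ring
    rw [h7]
    have : 0 < a * A.card := by positivity
    linarith
  have := mul_le_mul_of_nonneg_right h5 (Nat.cast_nonneg B4.card)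
  linarith

end part6


section part7
variable {G : Type*} [AddCommGroup G] [Fintype G]

lemma shift_sum {B : Finset G} {η : ℝ} {t : G} (h : ((B.filter (fun x => x - t ∉ B)).card : ℝ) ≤ η * B.card)
    (f : G → ℝ) (hf : ∀ x, 0 ≤ f x ∧ f x ≤ 1) :
    ∑ x ∈ B, f x ≤ ∑ x ∈ B, f (x + t) + η * B.card := by
  rw [← Finset.sum_filter_add_sum_filter_not B (fun x => x - t ∈ B) f]
  have h1 : ∑ x ∈ B.filter (fun x => x - t ∉ B), f x ≤ η * B.card := by
    refine le_trans ?_ h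
    calc _ ≤ ∑ x ∈ B.filter (fun x => x - t ∉ B), (1 : ℝ) := Finset.sum_le_sum fun x _ => (hf x).2
      _ = _ := by simp
  have h2 : ∑ x ∈ B.filter (fun x => x - t ∈ B), f x ≤ ∑ x ∈ B, f (x + t) := by
    have e1 : ∑ x ∈ B.filter (fun x => x - t ∈ B), f x =
        ∑ y ∈ (B.filter (fun x => x - t ∈ B)).image (fun x => x - t), f (y + t) := by
      rw [Finset.sum_image (by intro x _ y _ h; simpa using h)]
      simp
    rw [e1]
    refine Finset.sum_le_sum_of_subset_of_nonneg ?_ fun x _ _ => (hf _).1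
    intro y hy
    rw [Finset.mem_image] at hy
    obtain ⟨x, hx, rfl⟩ := hy
    exact (Finset.mem_filter.1 hx).2
  linarith

lemma reg_exists (Γ : Finset (AddChar G ℂ)) {ρ : ℝ} (hρ : 0 < ρ) {r ν : ℕ} (hν : r + 24 + Γ.card ≤ ν) :
    ∃ ρ', ρ / 2 ≤ ρ' ∧ ρ' ≤ ρ ∧
      (∀ t ∈ bohr Γ (ρ * (1 / 2) ^ (ν + 1)), (((bohr Γ ρ').filter (fun x => x - t ∉ bohr Γ ρ')).card : ℝ) ≤
        (1 / 2) ^ (r + 20) * (bohr Γ ρ').card) ∧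
      ((bohr Γ (ρ' + ρ * (1 / 2) ^ (ν + 1))).card : ℝ) ≤ 2 * (bohr Γ ρ').card := by
  have hη1 : (1 / 2 : ℝ) ^ (r + 20) ≤ 1 := pow_le_one₀ (by norm_num) (by norm_num)
  obtain ⟨ρ', h1, h2, h3⟩ := bohr_regular Γ (n := 2 ^ ν) hρ (by positivity : (0 : ℝ) < (1 / 2) ^ (r + 20)) hη1 (by
    have h5 : (10 * Γ.card : ℝ) < 2 ^ (4 + Γ.card) := by
      have : Γ.card < 2 ^ Γ.card := Nat.lt_two_pow_self
      have : 10 * Γ.card < 2 ^ (4 + Γ.card) := by rw [pow_add]; omega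
      exact_mod_cast this
    refine lt_of_lt_of_le h5 ?_
    have h6 : (2 : ℝ) ^ (4 + Γ.card + (r + 20)) ≤ 2 ^ ν := pow_le_pow_right₀ (by norm_num) (by omega)
    push_cast
    calc (2 : ℝ) ^ (4 + Γ.card) = 2 ^ (4 + Γ.card + (r + 20)) * (1 / 2) ^ (r + 20) := by
          rw [pow_add 2 (4 + Γ.card), mul_assoc, ← mul_pow]; norm_num
      _ ≤ _ := by gcongr)
  have e1 : ρ / (2 * ((2 ^ ν : ℕ) : ℝ)) = ρ * (1 / 2) ^ (ν + 1) := by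
    push_cast; rw [pow_succ, one_div, inv_pow]; field_simp
  rw [e1] at h3
  refine ⟨ρ', h1, h2, fun t ht => ?_, ?_⟩
  · exact shift_loss (bohr_mono (by have : 0 ≤ ρ * (1 / 2 : ℝ) ^ (ν + 1) := by positivity
                                    linarith)) h3 t (fun x hx => bohr_add_mem hx ht)
  · refine h3.trans ?_
    gcongr
    linarith

/-- halved characters -/
noncomputable def halve (h : G →+ G) (Γ : Finset (AddChar G ℂ)) : Finset (AddChar G ℂ) :=
  Γ.image (fun γ => γ.compAddMonoidHom h)

lemma mem_halve {h : G →+ G} {Γ : Finset (AddChar G ℂ)} {ρ : ℝ} {x : G} :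
    x ∈ bohr (halve h Γ) ρ ↔ h x ∈ bohr Γ ρ := by
  simp [mem_bohr, halve]

lemma halve_card (h : G →+ G) (Γ : Finset (AddChar G ℂ)) : (halve h Γ).card ≤ Γ.card := Finset.card_image_le

lemma halve_sub {h : G →+ G} (hh : ∀ x, h x + h x = x) {Γ : Finset (AddChar G ℂ)} {ρ : ℝ} {x : G}
    (hx : x ∈ bohr (halve h Γ) ρ) : x ∈ bohr Γ (2 * ρ) := by
  rw [mem_halve] at hx
  have := bohr_add_mem hx hx
  rw [hh] at this
  rwa [two_mul]

lemma halve_dbl {h : G →+ G} (hh : ∀ x, h x + h x = x) (x : G) : h (x + x) = x := by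
  rw [map_add, hh]

/-- density state -/
def Stt (A : Finset G) (Γ : Finset (AddChar G ℂ)) (ρ0 α : ℝ) : Prop :=
  ∀ ρ, 0 < ρ → ρ ≤ ρ0 → ∃ x, α * (bohr Γ ρ).card ≤ ((bohr Γ ρ).filter (fun b => x + b ∈ A)).card

/-- number of three-term progressions -/
noncomputable def T3 (A : Finset G) : ℝ := ∑ x, ∑ d, ind A x * ind A (x + d) * ind A (x + d + d)

lemma T3_eq (A : Finset G) (h : G →+ G) (hh : ∀ x, h x + h x = x) (z : G) :
    ∑ t, ∑ y, ind A (z + h t) * (ind A (z + y) * ind A (z + (t - y))) = T3 A := by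
  unfold T3
  rw [Finset.sum_comm, ← Equiv.sum_comp (Equiv.addLeft z) (fun x => ∑ d, ind A x * ind A (x + d) * ind A (x + d + d))]
  refine Finset.sum_congr rfl fun y _ => ?_
  let e1 : G ≃ G := ⟨fun t => h t - y, fun d => (d + y) + (d + y), fun t => by simp [hh], fun d => by
    simp only; rw [halve_dbl hh]; simp⟩
  rw [← Equiv.sum_comp e1 (fun d => ind A ((Equiv.addLeft z) y) * ind A ((Equiv.addLeft z) y + d) * ind A ((Equiv.addLeft z) y + d + d))]
  refine Finset.sum_congr rfl fun t _ => ?_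
  simp only [Equiv.coe_addLeft, e1, Equiv.coe_fn_mk]
  have a1 : z + y + (h t - y) = z + h t := by abel
  have a2 : z + h t + (h t - y) = z + (t - y) := by
    conv_rhs => rw [← hh t]
    abel
  rw [a1, a2]
  ring

lemma count_large {A A1 E : Finset G} (h : G →+ G) (hh : ∀ x, h x + h x = x) (z : G)
    (hA1 : ∀ y ∈ A1, z + y ∈ A) :
    ∑ u ∈ E, ∑ v ∈ E, ind A (z + h (u - v)) * cnv (ind A1) (ind A1) (u - v) ≤ E.card * T3 A := by
  have hle : ∀ t, ind A (z + h t) * cnv (ind A1) (ind A1) t ≤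
      ∑ y, ind A (z + h t) * (ind A (z + y) * ind A (z + (t - y))) := by
    intro t
    rw [cnv, Finset.mul_sum]
    have hi : ∀ y, ind A1 y ≤ ind A (z + y) := by
      intro y
      by_cases hy : y ∈ A1
      · simp [ind, hy, hA1 y hy]
      · have := ind_nonneg A (z + y)
        simpa [ind, hy] using this
    refine Finset.sum_le_sum fun y _ => ?_
    refine mul_le_mul_of_nonneg_left ?_ (ind_nonneg _ _)
    exact mul_le_mul (hi y) (hi _) (ind_nonneg _ _) (ind_nonneg _ _)
  have hnn : ∀ t, 0 ≤ ∑ y, ind A (z + h t) * (ind A (z + y) * ind A (z + (t - y))) := fun t =>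
    Finset.sum_nonneg fun y _ => mul_nonneg (ind_nonneg _ _) (mul_nonneg (ind_nonneg _ _) (ind_nonneg _ _))
  rw [Finset.sum_comm]
  calc _ ≤ ∑ v ∈ E, T3 A := by
        refine Finset.sum_le_sum fun v _ => ?_
        calc _ ≤ ∑ u ∈ E, ∑ y, ind A (z + h (u - v)) * (ind A (z + y) * ind A (z + (u - v - y))) :=
              Finset.sum_le_sum fun u _ => hle _
          _ ≤ ∑ u, ∑ y, ind A (z + h (u - v)) * (ind A (z + y) * ind A (z + (u - v - y))) :=
              Finset.sum_le_sum_of_subset_of_nonneg (Finset.subset_univ _) fun u _ _ => hnn _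
          _ = ∑ u, ∑ y, ind A (z + h u) * (ind A (z + y) * ind A (z + (u - y))) :=
              Equiv.sum_comp (Equiv.subRight v) (fun t => ∑ y, ind A (z + h t) * (ind A (z + y) * ind A (z + (t - y))))
          _ = T3 A := T3_eq A h hh z
    _ = _ := by simp

end part7


section part8
variable {G : Type*} [AddCommGroup G] [Fintype G]

lemma bohr_sum_mem {Γ : Finset (AddChar G ℂ)} {ρ : ℝ} {j : ℕ} (t : Fin j → G) (ht : ∀ i, t i ∈ bohr Γ ρ) :
    ∑ i, t i ∈ bohr Γ (j * ρ) := by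
  induction j with
  | zero => simpa using bohr_zero_mem Γ le_rfl
  | succ j ih =>
    rw [Fin.sum_univ_castSucc]
    have := bohr_add_mem (ih (fun i => t i.castSucc) (fun i => ht _)) (ht (Fin.last j))
    push_cast
    rwa [add_mul, one_mul]

lemma upper_dens {A P S : Finset G} (φ : G →+ G) (τ : G → G) (hP : P.Nonempty) {β η : ℝ}
    (hτ : ∀ p ∈ P, φ (τ p) = p)
    (hl : ∀ p ∈ P, ((S.filter (fun x => x - τ p ∉ S)).card : ℝ) ≤ η * S.card)
    (hd : ∀ x, ((P.filter (fun b => x + b ∈ A)).card : ℝ) ≤ β * P.card) (x : G) :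
    ∑ s ∈ S, ind A (x + φ s) ≤ (β + η) * S.card := by
  have hPc : (0 : ℝ) < P.card := by exact_mod_cast hP.card_pos
  have h1 : ∑ p ∈ P, ∑ s ∈ S, ind A (x + φ s) ≤ ∑ p ∈ P, (∑ s ∈ S, ind A (x + φ (s + τ p)) + η * S.card) :=
    Finset.sum_le_sum fun p hp => shift_sum (hl p hp) (fun s => ind A (x + φ s))
      (fun s => ⟨ind_nonneg _ _, ind_le_one _ _⟩)
  rw [Finset.sum_const, nsmul_eq_mul, Finset.sum_add_distrib, Finset.sum_comm, Finset.sum_const, nsmul_eq_mul] at h1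
  have h2 : ∑ s ∈ S, ∑ p ∈ P, ind A (x + φ (s + τ p)) ≤ ∑ s ∈ S, β * P.card := by
    refine Finset.sum_le_sum fun s _ => ?_
    refine le_trans (le_of_eq ?_) (hd (x + φ s))
    rw [← Finset.sum_boole]
    refine Finset.sum_congr rfl fun p hp => ?_
    rw [map_add, hτ p hp, ← add_assoc, ind]
  rw [Finset.sum_const, nsmul_eq_mul] at h2
  refine le_of_mul_le_mul_left ?_ hPc
  nlinarith

lemma lower_avg {ι : Type*} {A B : Finset G} (I : Finset ι) (t : ι → G) {α η : ℝ} {x0 : G}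
    (hl : ∀ i ∈ I, ((B.filter (fun x => x - t i ∉ B)).card : ℝ) ≤ η * B.card)
    (hd : α * B.card ≤ ((B.filter (fun b => x0 + b ∈ A)).card : ℝ)) :
    (α - η) * B.card * I.card ≤ ∑ x ∈ B, ∑ i ∈ I, ind A (x0 + x + t i) := by
  rw [Finset.sum_comm]
  calc (α - η) * B.card * I.card = ∑ i ∈ I, (α - η) * B.card := by
        rw [Finset.sum_const, nsmul_eq_mul]; ring
    _ ≤ _ := by
      refine Finset.sum_le_sum fun i hi => ?_
      have h1 := shift_sum (hl i hi) (fun s => ind A (x0 + s)) (fun s => ⟨ind_nonneg _ _, ind_le_one _ _⟩)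
      have h2 : ∑ x ∈ B, ind A (x0 + x) = ((B.filter (fun b => x0 + b ∈ A)).card : ℝ) := by
        rw [← Finset.sum_boole]; rfl
      rw [h2] at h1
      have h3 : ∑ x ∈ B, ind A (x0 + (x + t i)) = ∑ x ∈ B, ind A (x0 + x + t i) := by
        simp only [add_assoc]
      rw [h3] at h1
      linarith

lemma select {B : Finset G} (hB : B.Nonempty) (N1 N2 : G → ℝ) {m U : ℝ} (h1 : ∀ x, N1 x ≤ U) (h2 : ∀ x, N2 x ≤ U)
    (s1 : m * B.card ≤ ∑ x ∈ B, N1 x) (s2 : m * B.card ≤ ∑ x ∈ B, N2 x) :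
    ∃ x, 2 * m - U ≤ N1 x ∧ 2 * m - U ≤ N2 x := by
  by_contra hcon
  push Not at hcon
  have hlt : ∀ x, N1 x + N2 x < 2 * m := by
    intro x
    by_cases h : 2 * m - U ≤ N1 x
    · have := hcon x h
      linarith [h1 x]
    · push Not at h
      linarith [h2 x]
  have h3 : ∑ x ∈ B, (N1 x + N2 x) < ∑ x ∈ B, 2 * m := Finset.sum_lt_sum_of_nonempty hB fun x _ => hlt x
  rw [Finset.sum_add_distrib, Finset.sum_const, nsmul_eq_mul] at h3
  linarith

lemma prR_ge (l : ℕ) : l + 16 ≤ prR l := by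
  have h1 : 1 ≤ prS l + 1 := by omega
  have h2 : prK l ≤ prM l := by
    unfold prM
    have : 1 ≤ prK l := by unfold prK; omega
    nlinarith [Nat.zero_le (prS l)]
  have h3 : prM l ≤ prM l * (prS l + 1) := Nat.le_mul_of_pos_right _ (by omega)
  unfold prR prMM
  unfold prK at h2
  omega

lemma size_aux {Γ : Finset (AddChar G ℂ)} {d s : ℕ} {ρ : ℝ} (hd : Γ.card ≤ d) (hρ : 2 * (1 / 2) ^ s ≤ ρ) :
    (Fintype.card G : ℝ) ≤ 81 ^ (d * s) * (bohr Γ ρ).card := by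
  have := bohr_size Γ s
  have h6 : (Fintype.card G : ℝ) ≤ 81 ^ (Γ.card * s) * (bohr Γ (2 * (1 / 2) ^ s)).card := by exact_mod_cast this
  refine h6.trans ?_
  gcongr
  · norm_num
  · exact bohr_mono hρ

lemma final_arith {a b E S T g : ℝ} {l D : ℕ} (hal : (1 / 2 : ℝ) ^ l ≤ a) (hws : (1 / 2 : ℝ) ^ l * E ^ 2 ≤ S)
    (hc2 : 1 / 2 * a ^ 2 * b * S ≤ E * T) (hb : 0 < b) (hE : 0 < E) (hg : 0 ≤ g)
    (z1 : g ≤ 81 ^ D * b) (z2 : g ≤ 81 ^ D * E) :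
    g ^ 2 ≤ 2 ^ (3 * l + 1) * 81 ^ (2 * D) * T := by
  have ha0 : 0 < a := lt_of_lt_of_le (by positivity) hal
  have h3 : 1 / 2 * ((1 / 2 : ℝ) ^ l) ^ 2 * b * ((1 / 2 : ℝ) ^ l * E ^ 2) ≤ E * T := by
    refine le_trans ?_ hc2
    gcongr
  have h4 : (1 / 2 : ℝ) ^ (3 * l + 1) * (b * E) ≤ T := by
    refine le_of_mul_le_mul_left (le_trans (le_of_eq ?_) h3) hE
    rw [pow_succ, pow_mul']; ring
  have h5 : b * E ≤ 2 ^ (3 * l + 1) * T := by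
    calc b * E = 2 ^ (3 * l + 1) * ((1 / 2 : ℝ) ^ (3 * l + 1) * (b * E)) := by
          rw [← mul_assoc, ← mul_pow]; norm_num
      _ ≤ _ := by gcongr
  calc g ^ 2 = g * g := sq _
    _ ≤ (81 ^ D * b) * (81 ^ D * E) := by gcongr
    _ = 81 ^ (2 * D) * (b * E) := by rw [two_mul, pow_add]; ring
    _ ≤ 81 ^ (2 * D) * (2 ^ (3 * l + 1) * T) := by gcongr
    _ = _ := by ring

set_option maxHeartbeats 1600000 in
lemma step (h : G →+ G) (hh : ∀ x, h x + h x = x) {A : Finset G} {Γ : Finset (AddChar G ℂ)} {α : ℝ}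
    {L d s ν : ℕ} (hα : (1 / 2 : ℝ) ^ L ≤ α) (hd : Γ.card ≤ d) (hν : prR (L + 1) + 24 + d ≤ ν)
    (hS : Stt A Γ (2 * (1 / 2) ^ s) α) :
    (Fintype.card G : ℝ) ^ 2 ≤ 2 ^ (3 * (L + 1) + 1) * 81 ^ (2 * (d * (s + (4 * ν + 11 + prK (L + 1))))) * T3 A ∨
    ∃ Γ' : Finset (AddChar G ℂ), Γ'.card ≤ d + prR (L + 1) ∧
      Stt A Γ' (2 * (1 / 2) ^ (s + (4 * ν + 11 + prK (L + 1)))) (1001 / 1000 * α) := by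
  set l := L + 1 with hl
  set k := prK l with hk
  set r0 := prR l with hr0
  set s' := s + (4 * ν + 11 + k) with hs'
  set η : ℝ := (1 / 2) ^ (r0 + 20) with hη
  have hα0 : 0 < α := lt_of_lt_of_le (by positivity) hα
  have hrl : l + 16 ≤ r0 := prR_ge l
  have hηα : η ≤ α / 2 ^ 20 := by
    have : η ≤ (1 / 2) ^ (L + 20) := pow_le_pow_of_le_one (by norm_num) (by norm_num) (by omega)
    rw [pow_add] at this
    have e1 : (1 / 2 : ℝ) ^ L * (1 / 2) ^ 20 ≤ α * (1 / 2) ^ 20 := by gcongr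
    calc η ≤ _ := this
      _ ≤ _ := e1
      _ = _ := by norm_num; ring
  have hη0 : 0 < η := by positivity
  -- radii
  set ρ0 : ℝ := 2 * (1 / 2) ^ s with hρ0
  set δ : ℝ := (1 / 2) ^ (ν + 1) with hδ
  have hδ0 : 0 < δ := by positivity
  have hδ1 : δ ≤ 1 / 2 := by
    have : δ ≤ (1 / 2) ^ 1 := pow_le_pow_of_le_one (by norm_num) (by norm_num) (by omega)
    simpa using this
  have hρ00 : 0 < ρ0 := by positivity
  have hρ4 : 2 * (1 / 2 : ℝ) ^ s' = ρ0 * δ / 8 * δ / 8 * δ * (1 / 2) ^ (k + 1) * δ := by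
    rw [hs', hρ0, hδ]
    have : s + (4 * ν + 11 + k) = s + (ν + 1) + 3 + (ν + 1) + 3 + (ν + 1) + (k + 1) + (ν + 1) - 0 := by omega
    rw [this]
    simp only [Nat.sub_zero]
    simp only [pow_add]
    ring
  set ρ4 : ℝ := 2 * (1 / 2 : ℝ) ^ s' with hρ4'
  have hρ40 : 0 < ρ4 := by positivity
  set g1 := ρ0 * δ with hg1
  have hg10 : 0 < g1 := by positivity
  set g' := g1 / 8 * δ with hg'
  have hg'0 : 0 < g' := by positivity
  set g2 := g' / 8 * δ with hg2
  have hg20 : 0 < g2 := by positivity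
  have hρ4'' : ρ4 = g2 * (1 / 2) ^ (k + 1) * δ := by rw [hρ4]
  set Γ1 := halve h Γ with hΓ1
  have hΓ1c : Γ1.card ≤ d := (halve_card h Γ).trans hd
  obtain ⟨ρ1, r11, r12, r13, -⟩ := reg_exists Γ hρ00 (r := r0) (ν := ν) (by omega)
  obtain ⟨ρ', r'1, r'2, r'3, r'4⟩ := reg_exists Γ (by positivity : 0 < g1 / 8) (r := r0) (ν := ν) (by omega)
  obtain ⟨ρ2, r21, r22, r23, r24⟩ := reg_exists Γ1 (by positivity : 0 < g' / 8) (r := r0) (ν := ν) (by omega)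
  obtain ⟨ρ3, r31, r32, r33, -⟩ := reg_exists Γ1 (by positivity : 0 < g2 * (1 / 2) ^ (k + 1)) (r := r0) (ν := ν) (by omega)
  rw [← hδ, ← hη] at r13 r'3 r23 r33
  rw [← hδ] at r'4 r24
  rw [← hg1] at r13
  rw [← hg'] at r'3 r'4
  rw [← hg2] at r23 r24
  rw [← hρ4''] at r33
  have hk2 : (1 / 2 : ℝ) ^ (k + 1) ≤ 1 / 2 := by
    have : (1 / 2 : ℝ) ^ (k + 1) ≤ (1 / 2) ^ 1 := pow_le_pow_of_le_one (by norm_num) (by norm_num) (by omega)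
    simpa using this
  have o1 : g1 ≤ ρ0 / 2 := by have := mul_le_mul_of_nonneg_left hδ1 hρ00.le; linarith
  have o2 : g' ≤ g1 / 16 := by have := mul_le_mul_of_nonneg_left hδ1 hg10.le; linarith
  have o3 : g2 ≤ g' / 16 := by have := mul_le_mul_of_nonneg_left hδ1 hg'0.le; linarith
  have hG : g2 * (1 / 2) ^ (k + 1) ≤ g2 / 2 := by have := mul_le_mul_of_nonneg_left hk2 hg20.le; linarith
  have hG0 : 0 < g2 * (1 / 2) ^ (k + 1) := by positivity
  have o4 : ρ4 ≤ g2 * (1 / 2) ^ (k + 1) / 2 := by have := mul_le_mul_of_nonneg_left hδ1 hG0.le; linarith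
  have hs4 : ρ4 ≤ 1 / (2000 * r0) := by
    have hr00 : (0 : ℝ) < r0 := by
      have : 0 < r0 := by omega
      exact_mod_cast this
    rw [le_div_iff₀ (by positivity)]
    have h1 : ρ4 ≤ 2 * (1 / 2) ^ (r0 + 20) := by
      rw [hρ4']
      refine mul_le_mul_of_nonneg_left ?_ (by norm_num)
      exact pow_le_pow_of_le_one (by norm_num) (by norm_num) (by omega)
    have h2 : (r0 : ℝ) ≤ 2 ^ r0 := by
      have : r0 < 2 ^ r0 := Nat.lt_two_pow_self
      exact_mod_cast this.le
    calc ρ4 * (2000 * r0) ≤ (2 * (1 / 2) ^ (r0 + 20)) * (2000 * 2 ^ r0) := by gcongr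
      _ = 4000 * (1 / 2) ^ 20 * ((1 / 2) ^ r0 * 2 ^ r0) := by rw [pow_add]; ring
      _ ≤ 1 := by rw [← mul_pow]; norm_num
  -- case split
  by_cases hcase : Stt A Γ ρ4 (1001 / 1000 * α)
  · exact Or.inr ⟨Γ, by omega, hcase⟩
  unfold Stt at hcase
  push Not at hcase
  obtain ⟨σ, hσ0, hσ4, hσ⟩ := hcase
  set P := bohr Γ σ with hP
  have hPn : P.Nonempty := Finset.card_pos.1 (bohr_card_pos Γ hσ0.le)
  set B := bohr Γ ρ1 with hB
  set B' := bohr Γ ρ' with hB'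
  set E := bohr Γ1 ρ2 with hE
  set E3 := bohr Γ1 ρ3 with hE3
  have hρ10 : 0 < ρ1 := by linarith
  have hρ'0 : 0 < ρ' := by linarith
  have hρ20 : 0 < ρ2 := by linarith
  have hρ30 : 0 < ρ3 := by linarith
  have hBn : B.Nonempty := Finset.card_pos.1 (bohr_card_pos Γ hρ10.le)
  have hB'c : (0 : ℝ) < B'.card := by exact_mod_cast bohr_card_pos Γ hρ'0.le
  have hEn : E.Nonempty := Finset.card_pos.1 (bohr_card_pos Γ1 hρ20.le)
  have hEc : (0 : ℝ) < E.card := by exact_mod_cast bohr_card_pos Γ1 hρ20.le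
  have hE3n : E3.Nonempty := Finset.card_pos.1 (bohr_card_pos Γ1 hρ30.le)
  have up1 : ∀ x, ∑ y ∈ B', ind A (x + y) ≤ (1001 / 1000 * α + η) * B'.card := by
    intro x
    refine upper_dens (AddMonoidHom.id G) (fun p => p) hPn (fun p _ => rfl) (fun p hp => ?_) (fun x => (hσ x).le) x
    exact r'3 p (bohr_mono (by linarith) hp)
  have up2 : ∀ x, ∑ u ∈ E, ind A (x + h u) ≤ (1001 / 1000 * α + η) * E.card := by
    intro x
    refine upper_dens h (fun p => p + p) hPn (fun p _ => halve_dbl hh p) (fun p hp => ?_) (fun x => (hσ x).le) x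
    refine r23 _ (bohr_mono (by linarith : σ ≤ g2) ?_)
    rw [mem_halve, halve_dbl hh]
    exact hp
  obtain ⟨x0, hx0⟩ := hS ρ1 hρ10 r12
  have lo1 := lower_avg B' (fun y => y) (A := A) (B := B) (η := η) (x0 := x0)
    (fun y hy => r13 y (bohr_mono (by linarith) hy)) hx0
  have lo2 := lower_avg (E ×ˢ E) (fun p => h (p.1 - p.2)) (A := A) (B := B) (η := η) (x0 := x0)
    (fun p hp => r13 _ (by
      rw [Finset.mem_product] at hp
      have := bohr_sub_mem hp.1 hp.2
      rw [mem_halve] at this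
      exact bohr_mono (by linarith) this)) hx0
  obtain ⟨x, hx1, hx2⟩ := select hBn (fun x => (∑ y ∈ B', ind A (x0 + x + y)) / B'.card)
    (fun x => (∑ p ∈ E ×ˢ E, ind A (x0 + x + h (p.1 - p.2))) / (E.card : ℝ) ^ 2)
    (m := α - η) (U := 1001 / 1000 * α + η)
    (fun x => by rw [div_le_iff₀ hB'c]; exact up1 _)
    (fun x => by
      rw [div_le_iff₀ (by positivity), Finset.sum_product_right]
      calc _ ≤ ∑ v ∈ E, (1001 / 1000 * α + η) * E.card := by
            refine Finset.sum_le_sum fun v _ => ?_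
            refine le_trans (le_of_eq ?_) (up2 (x0 + x - h v))
            refine Finset.sum_congr rfl fun u _ => ?_
            rw [map_sub]; congr 1; abel
        _ = _ := by rw [Finset.sum_const, nsmul_eq_mul]; ring)
    (by rw [← Finset.sum_div, le_div_iff₀ hB'c]; exact lo1)
    (by
      rw [← Finset.sum_div, le_div_iff₀ (by positivity)]
      refine le_trans (le_of_eq ?_) lo2
      rw [Finset.card_product]; push_cast; ring)
  set z := x0 + x with hz
  set A1 := B'.filter (fun y => z + y ∈ A) with hA1
  have hA1c : ∑ y ∈ B', ind A (z + y) = (A1.card : ℝ) := by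
    rw [hA1, ← Finset.sum_boole]; rfl
  rw [hA1c] at hx1
  set a : ℝ := A1.card / B'.card with ha
  have hal2 : 996 / 1000 * α ≤ a := le_trans (by linarith) hx1
  have hall : (1 / 2 : ℝ) ^ l ≤ 996 / 1000 * α := by
    rw [hl, pow_succ]; linarith
  have hal : (1 / 2 : ℝ) ^ l ≤ a := hall.trans hal2
  have ha1 : a ≤ 1 := by
    rw [ha, div_le_one hB'c]
    exact_mod_cast Finset.card_filter_le _ _
  have hacard : (A1.card : ℝ) = a * B'.card := by rw [ha]; field_simp
  have hws : (1 / 2 : ℝ) ^ l * (E.card : ℝ) ^ 2 ≤ ∑ u ∈ E, ∑ v ∈ E, ind A (z + h (u - v)) := by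
    rw [← Finset.sum_product']
    have := (hall.trans (by linarith : 996 / 1000 * α ≤ 2 * (α - η) - (1001 / 1000 * α + η))).trans hx2
    rwa [le_div_iff₀ (by positivity)] at this
  have hEsub : ∀ u ∈ E, u ∈ bohr Γ (2 * ρ2) := fun u hu => halve_sub hh hu
  by_cases hcount : ∑ u ∈ E, ∑ v ∈ E, ind A (z + h (u - v)) * cnv (ind A1) (ind A1) (u - v) ≤
      1 / 2 * a ^ 2 * B'.card * ∑ u ∈ E, ∑ v ∈ E, ind A (z + h (u - v))
  · -- density increment
    right
    obtain ⟨Δ, hΔc, hΔ⟩ := core (A := A1) (B := B') (E := E) (E3 := E3) (H := bohr Γ (ρ' + g')) (W := bohr Γ1 (ρ2 + g2))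
      (w := fun t => ind A (z + h t)) (a := a) (η := η) (l := l) (Finset.filter_subset _ _)
      (fun x hx => bohr_neg_mem hx) hEn (fun x hx => bohr_neg_mem hx) ha1 hal hacard
      (bohr_card_pos Γ hρ'0.le)
      (fun u hu v hv => r'3 _ (by
        have := bohr_sub_mem (hEsub u hu) (hEsub v hv)
        exact bohr_mono (by linarith) this))
      (by linarith) (fun t => by simp only [ind]; split_ifs <;> simp) hcount hws
      (fun x hx u hu => by
        have := bohr_sub_mem (Finset.mem_of_mem_filter _ hx) (hEsub u hu)
        exact bohr_mono (by linarith) this) r'4 hE3n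
      (fun u hu t ht => bohr_mono (by linarith) (bohr_sub_mem hu ht)) r24
      (fun j hj t t' ht ht' x hx => by
        have h1 := bohr_add_mem hx (bohr_sub_mem (bohr_sum_mem t' ht') (bohr_sum_mem t ht))
        refine bohr_mono ?_ h1
        have hj2 : (j : ℝ) ≤ 2 ^ k := by
          have : k < 2 ^ k := Nat.lt_two_pow_self
          exact_mod_cast (hj.trans this.le)
        have : (j : ℝ) * ρ3 ≤ 2 ^ k * (g2 * (1 / 2) ^ (k + 1)) := by gcongr
        have e2 : (2 : ℝ) ^ k * (g2 * (1 / 2) ^ (k + 1)) = g2 / 2 := by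
          rw [pow_succ]
          have : (2 : ℝ) ^ k * (1 / 2) ^ k = 1 := by rw [← mul_pow]; norm_num
          linear_combination (g2 / 2) * this
        linarith)
    refine ⟨Γ1 ∪ Δ, (Finset.card_union_le _ _).trans (by omega), ?_⟩
    intro ρ hρ0' hρle
    obtain ⟨y, hy⟩ := hΔ (bohr (Γ1 ∪ Δ) ρ) (fun b hb => by
      have hb1 : b ∈ bohr Γ1 ρ4 := bohr_mono hρle (bohr_anti Finset.subset_union_left hb)
      refine ⟨bohr_mono (hρle.trans hs4) (bohr_anti Finset.subset_union_right hb), ?_, r33 b hb1⟩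
      have := r33 (-b) (bohr_neg_mem hb1)
      simp only [sub_neg_eq_add] at this
      exact this)
    refine ⟨z + y, le_trans ?_ (hy.trans ?_)⟩
    · exact mul_le_mul_of_nonneg_right (by linarith) (Nat.cast_nonneg _)
    · norm_cast
      refine Finset.card_le_card ?_
      intro b hb
      rw [Finset.mem_filter] at hb ⊢
      refine ⟨hb.1, ?_⟩
      have := (Finset.mem_filter.1 hb.2).2
      rwa [← add_assoc] at this
  · left
    push Not at hcount
    have hc2 := hcount.le.trans (count_large h hh z (A1 := A1) (E := E) (fun y hy => (Finset.mem_filter.1 hy).2))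
    have z1 : (Fintype.card G : ℝ) ≤ 81 ^ (d * s') * B'.card :=
      size_aux hd (by linarith)
    have z2 : (Fintype.card G : ℝ) ≤ 81 ^ (d * s') * E.card :=
      size_aux hΓ1c (by linarith)
    exact final_arith hal hws hc2 hB'c hEc (Nat.cast_nonneg _) z1 z2

end part8


/-- polynomially bounded -/
def PB (f : ℕ → ℕ) : Prop := ∃ K n : ℕ, ∀ l, 1 ≤ l → f l ≤ K * l ^ n

lemma PB.const (c : ℕ) : PB (fun _ => c) := ⟨c, 0, fun l _ => by simp⟩
lemma PB.id : PB (fun l => l) := ⟨1, 1, fun l _ => by simp⟩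
lemma PB.add {f g : ℕ → ℕ} (hf : PB f) (hg : PB g) : PB (fun l => f l + g l) := by
  obtain ⟨K, n, h⟩ := hf
  obtain ⟨K', n', h'⟩ := hg
  refine ⟨K + K', n + n', fun l hl => ?_⟩
  rw [add_mul]
  refine add_le_add ((h l hl).trans ?_) ((h' l hl).trans ?_)
  · exact Nat.mul_le_mul_left _ (Nat.pow_le_pow_right hl (by omega))
  · exact Nat.mul_le_mul_left _ (Nat.pow_le_pow_right hl (by omega))
lemma PB.mul {f g : ℕ → ℕ} (hf : PB f) (hg : PB g) : PB (fun l => f l * g l) := by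
  obtain ⟨K, n, h⟩ := hf
  obtain ⟨K', n', h'⟩ := hg
  refine ⟨K * K', n + n', fun l hl => ?_⟩
  calc f l * g l ≤ (K * l ^ n) * (K' * l ^ n') := Nat.mul_le_mul (h l hl) (h' l hl)
    _ = _ := by ring
lemma PB.sq {f : ℕ → ℕ} (hf : PB f) : PB (fun l => f l ^ 2) := by
  simp only [pow_two]; exact hf.mul hf

/-- total exponents -/
def prJ (l : ℕ) : ℕ := 1000 * l
def prNu (l : ℕ) : ℕ := prR l + 24 + prJ l * prR l
def prQ (l : ℕ) : ℕ := 4 * prNu l + 11 + prK l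
def prX (l : ℕ) : ℕ := (3 * l + 1) + 7 * (2 * ((prJ l * prR l) * (prJ l * prQ l)))

lemma PB_prX : PB prX := by
  have c := PB.const
  have i := PB.id
  have hP : PB prP := ((c 2).mul i).add (c 40)
  have hS : PB prS := ((c 8).mul hP).mul (((c 2).mul i).add (c 1))
  have hK : PB prK := i.add (c 10)
  have hM : PB prM := ((c 4).mul ((c 4000).mul hK).sq).mul ((hS.add hK).add (c 16))
  have hMM : PB prMM := (c 1).add (hM.mul (hS.add (c 1)))
  have hR : PB prR := (c 16).mul (hMM.add (c 1))
  have hJ : PB prJ := (c 1000).mul i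
  have hN : PB prNu := (hR.add (c 24)).add (hJ.mul hR)
  have hQ : PB prQ := (((c 4).mul hN).add (c 11)).add hK
  exact (((c 3).mul i).add (c 1)).add ((c 7).mul ((c 2).mul ((hJ.mul hR).mul (hJ.mul hQ))))

section part9
variable {G : Type*} [AddCommGroup G] [Fintype G]

lemma T3_nonneg (A : Finset G) : 0 ≤ T3 A :=
  Finset.sum_nonneg fun _ _ => Finset.sum_nonneg fun _ _ =>
    mul_nonneg (mul_nonneg (ind_nonneg _ _) (ind_nonneg _ _)) (ind_nonneg _ _)

lemma iterate (h : G →+ G) (hh : ∀ x, h x + h x = x) {A : Finset G} {L : ℕ}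
    (hA : (1 / 2 : ℝ) ^ L * Fintype.card G ≤ A.card) :
    (Fintype.card G : ℝ) ^ 2 ≤ 2 ^ (prX (L + 1)) * T3 A := by
  set l := L + 1 with hl
  have hT := T3_nonneg A
  by_contra hcon
  have main : ∀ j, j ≤ prJ l → ∃ Γ : Finset (AddChar G ℂ), Γ.card ≤ j * prR l ∧
      Stt A Γ (2 * (1 / 2) ^ (j * prQ l)) ((1001 / 1000) ^ j * (1 / 2) ^ L) := by
    intro j
    induction j with
    | zero =>
      intro _
      refine ⟨∅, by simp, fun ρ _ _ => ⟨0, ?_⟩⟩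
      have e1 : bohr (∅ : Finset (AddChar G ℂ)) ρ = Finset.univ := by
        ext x; simp [mem_bohr]
      rw [e1]
      simpa using hA
    | succ j ih =>
      intro hj
      obtain ⟨Γ, hΓ, hS⟩ := ih (by omega)
      have hjr : j * prR l ≤ prJ l * prR l := Nat.mul_le_mul_right _ (by omega)
      rcases step h hh (L := L) (ν := prNu l) (le_mul_of_one_le_left (by positivity) (one_le_pow₀ (by norm_num)))
        hΓ (by rw [← hl]; unfold prNu; omega) hS with hbig | ⟨Γ', hΓ', hS'⟩
      · exfalso
        apply hcon
        refine hbig.trans (mul_le_mul_of_nonneg_right ?_ hT)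
        have e1 : j * prQ l + (4 * prNu l + 11 + prK (L + 1)) = (j + 1) * prQ l := by
          rw [add_mul, one_mul]; rfl
        rw [e1]
        have hle : 2 * ((j * prR l) * ((j + 1) * prQ l)) ≤ 2 * ((prJ l * prR l) * (prJ l * prQ l)) :=
          Nat.mul_le_mul_left _ (Nat.mul_le_mul hjr (Nat.mul_le_mul_right _ hj))
        unfold prX
        rw [pow_add 2 (3 * l + 1), pow_mul 2 7]
        refine mul_le_mul_of_nonneg_left ?_ (by positivity)
        calc (81 : ℝ) ^ (2 * ((j * prR l) * ((j + 1) * prQ l))) ≤ (2 ^ 7) ^ (2 * ((j * prR l) * ((j + 1) * prQ l))) :=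
              pow_le_pow_left₀ (by norm_num) (by norm_num) _
          _ ≤ _ := pow_le_pow_right₀ (by norm_num) hle
      · refine ⟨Γ', hΓ'.trans (by rw [← hl, add_mul, one_mul]), ?_⟩
        have e1 : j * prQ l + (4 * prNu l + 11 + prK (L + 1)) = (j + 1) * prQ l := by
          rw [add_mul, one_mul]; rfl
        rw [e1] at hS'
        rw [pow_succ, mul_comm _ (1001 / 1000 : ℝ), mul_assoc]
        exact hS'
  obtain ⟨Γ, -, hS⟩ := main _ le_rfl
  obtain ⟨x, hx⟩ := hS _ (by positivity) le_rfl
  set P := bohr Γ (2 * (1 / 2) ^ (prJ l * prQ l)) with hP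
  have hPc : (0 : ℝ) < P.card := by exact_mod_cast bohr_card_pos Γ (by positivity)
  have h1 : ((P.filter (fun b => x + b ∈ A)).card : ℝ) ≤ P.card := by exact_mod_cast Finset.card_filter_le _ _
  have h2 : (2 : ℝ) ≤ (1001 / 1000) ^ (prJ l) * (1 / 2) ^ L := by
    have hb : (2 : ℝ) ≤ (1001 / 1000) ^ 1000 := by
      have := one_add_mul_le_pow (a := (1 / 1000 : ℝ)) (by norm_num) 1000
      have e : (1 + 1 / 1000 : ℝ) = 1001 / 1000 := by norm_num
      rw [e] at this
      refine le_trans ?_ this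
      norm_num
    unfold prJ
    rw [pow_mul]
    calc (2 : ℝ) = 2 ^ l * (1 / 2) ^ L := by
          rw [hl, pow_succ, mul_right_comm, ← mul_pow]; norm_num
      _ ≤ _ := by gcongr
  nlinarith

end part9

lemma density_T3 : ∃ K n : ℕ, ∀ (G : Type) [AddCommGroup G] [Fintype G] (h : G →+ G), (∀ x, h x + h x = x) →
    ∀ (A : Finset G) (L : ℕ), (1 / 2 : ℝ) ^ L * Fintype.card G ≤ A.card →
    (Fintype.card G : ℝ) ^ 2 ≤ 2 ^ (K * (L + 1) ^ n) * T3 A := by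
  obtain ⟨K, n, hK⟩ := PB_prX
  refine ⟨K, n, fun G _ _ h hh A L hA => (iterate h hh hA).trans ?_⟩
  exact mul_le_mul_of_nonneg_right (pow_le_pow_right₀ (by norm_num) (hK _ (by omega))) (T3_nonneg A)

lemma sum_range_zmod (N : ℕ) [NeZero N] (F : ℕ → ℝ) : ∑ n ∈ Finset.range N, F n = ∑ z : ZMod N, F z.val := by
  refine Finset.sum_bij' (fun n _ => (n : ZMod N)) (fun z _ => z.val) (fun _ _ => Finset.mem_univ _)
    (fun z _ => Finset.mem_range.2 (ZMod.val_lt z)) (fun n hn => ?_) (fun z _ => ?_) (fun n hn => ?_)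
  · exact ZMod.val_natCast_of_lt (Finset.mem_range.1 hn)
  · simp
  · rw [ZMod.val_natCast_of_lt (Finset.mem_range.1 hn)]

lemma lam3_zmod (N : ℕ) [NeZero N] (f : ℕ → ℝ) :
    lam3 N f f f = ∑ x : ZMod N, ∑ d : ZMod N, f x.val * f (x + d).val * f (x + d + d).val := by
  unfold lam3
  rw [sum_range_zmod N (fun x => ∑ d ∈ Finset.range N, f x * f ((x + d) % N) * f ((x + 2 * d) % N))]
  refine Finset.sum_congr rfl fun x _ => ?_
  rw [sum_range_zmod N (fun d => f x.val * f ((x.val + d) % N) * f ((x.val + 2 * d) % N))]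
  refine Finset.sum_congr rfl fun d _ => ?_
  have e1 : (x + d).val = (x.val + d.val) % N := ZMod.val_add _ _
  have e2 : (x + d + d).val = (x.val + 2 * d.val) % N := by
    rw [ZMod.val_add, ZMod.val_add, Nat.mod_add_mod, two_mul, add_assoc]
  rw [e1, e2]

lemma param_choice {C : ℝ} (hC : 2 ≤ C) (n : ℕ) : ∃ K2 : ℝ, 0 < K2 ∧ ∀ α : ℝ, 0 < α → α < 1 / 2 →
    ∃ L : ℕ, (1 / 2 : ℝ) ^ L ≤ α / (2 * C) ∧ ((L : ℝ) + 1) ^ n ≤ K2 * (α⁻¹ * Real.log (1 / α) ^ 5) := by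
  set K1 : ℝ := 2 * (2 * Real.log (2 * C) + 2) + 2 with hK1
  have hlC : 0 ≤ Real.log (2 * C) := Real.log_nonneg (by linarith)
  have hK10 : 0 < K1 := by positivity
  refine ⟨K1 ^ n * (n.factorial * 32), by positivity, fun α h0 h1 => ?_⟩
  set x := Real.log (1 / α) with hx
  have hlog2 : (1 / 2 : ℝ) < Real.log 2 := by have := Real.log_two_gt_d9; linarith
  have hx2 : 1 / 2 ≤ x := by
    refine hlog2.le.trans (Real.log_le_log (by norm_num) ?_)
    rw [le_div_iff₀ h0]; linarith
  have hex : Real.exp x = α⁻¹ := by rw [hx, Real.exp_log (by positivity), one_div]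
  set y := Real.log (2 * C) + x with hy
  have hy0 : 0 ≤ y := by positivity
  refine ⟨⌈2 * y⌉₊, ?_, ?_⟩
  · have hL : 2 * y ≤ ⌈2 * y⌉₊ := Nat.le_ceil _
    have e1 : α / (2 * C) = Real.exp (-y) := by
      rw [hy, neg_add, Real.exp_add, Real.exp_neg, Real.exp_neg, hex, Real.exp_log (by linarith), inv_inv]
      field_simp
    have e2 : (1 / 2 : ℝ) ^ ⌈2 * y⌉₊ = Real.exp (-(⌈2 * y⌉₊ * Real.log 2)) := by
      rw [Real.exp_neg, Real.exp_nat_mul, Real.exp_log (by norm_num), one_div, inv_pow]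
    rw [e1, e2]
    apply Real.exp_le_exp.2
    nlinarith
  · have hL : (⌈2 * y⌉₊ : ℝ) < 2 * y + 1 := Nat.ceil_lt_add_one (by positivity)
    have h3 : (⌈2 * y⌉₊ : ℝ) + 1 ≤ K1 * x := by rw [hK1]; nlinarith
    have h4 : x ^ n ≤ n.factorial * α⁻¹ := by
      have := Real.pow_div_factorial_le_exp x (by linarith) n
      rw [hex, div_le_iff₀ (by positivity)] at this
      linarith
    have h5 : 1 ≤ 32 * x ^ 5 := by
      have : (1 / 2 : ℝ) ^ 5 ≤ x ^ 5 := pow_le_pow_left₀ (by norm_num) hx2 5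
      norm_num at this ⊢
      linarith
    calc ((⌈2 * y⌉₊ : ℝ) + 1) ^ n ≤ (K1 * x) ^ n := pow_le_pow_left₀ (by positivity) h3 n
      _ = K1 ^ n * x ^ n := mul_pow _ _ _
      _ ≤ K1 ^ n * (n.factorial * α⁻¹) := by gcongr
      _ ≤ K1 ^ n * (n.factorial * α⁻¹) * (32 * x ^ 5) := le_mul_of_one_le_right (by positivity) h5
      _ = _ := by ring

lemma lam3_ge (N : ℕ) [NeZero N] (a₁ : ℕ → ℝ) {τ : ℝ} (hτ : 0 ≤ τ) (h0 : ∀ n, n < N → 0 ≤ a₁ n) (A : Finset (ZMod N))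
    (hA : ∀ z ∈ A, τ ≤ a₁ z.val) : τ ^ 3 * T3 A ≤ lam3 N a₁ a₁ a₁ := by
  rw [lam3_zmod, T3, Finset.mul_sum]
  have hi : ∀ z : ZMod N, τ * ind A z ≤ a₁ z.val := by
    intro z
    by_cases hz : z ∈ A
    · simpa [ind, hz] using hA z hz
    · simpa [ind, hz] using h0 _ (ZMod.val_lt z)
  refine Finset.sum_le_sum fun x _ => ?_
  rw [Finset.mul_sum]
  refine Finset.sum_le_sum fun d _ => ?_
  have p : ∀ z : ZMod N, 0 ≤ τ * ind A z := fun z => mul_nonneg hτ (ind_nonneg _ _)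
  calc τ ^ 3 * (ind A x * ind A (x + d) * ind A (x + d + d)) =
      (τ * ind A x) * (τ * ind A (x + d)) * (τ * ind A (x + d + d)) := by ring
    _ ≤ _ := mul_le_mul (mul_le_mul (hi _) (hi _) (p _) (h0 _ (ZMod.val_lt _))) (hi _) (p _)
      (mul_nonneg (h0 _ (ZMod.val_lt _)) (h0 _ (ZMod.val_lt _)))

/-- **Lemma 5.7 of the paper (Varnavides-type lower bound).** Let `N` be an odd prime,
`α ∈ (0, 1/2)`, `C ≥ 2`, and `a₁ : ℤ_N → [0, ∞)` with `∑ a₁ ≥ α` and `a₁ ≤ C/N`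
pointwise. Then `Λ₃(a₁, a₁, a₁) ≥ C₂ N⁻¹ exp(-C₃ α⁻¹ log⁵(1/α))` for constants
`C₂, C₃ > 0` depending only on `C`. -/
theorem trilinear_form_lower_bound (C : ℝ) (hC : 2 ≤ C) :
    ∃ C₂ > 0, ∃ C₃ > 0, ∀ N : ℕ, N.Prime → Odd N →
      ∀ α : ℝ, 0 < α → α < 1 / 2 →
      ∀ a₁ : ℕ → ℝ, (∀ n, n < N → 0 ≤ a₁ n) → (∀ n, n < N → a₁ n ≤ C / N) →
      α ≤ ∑ n ∈ Finset.range N, a₁ n →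
      C₂ * (N : ℝ)⁻¹ * Real.exp (-C₃ * α⁻¹ * Real.log (1 / α) ^ 5) ≤ lam3 N a₁ a₁ a₁ := by
  obtain ⟨K, n, hK⟩ := density_T3
  obtain ⟨K2, hK2, hpar⟩ := param_choice hC n
  refine ⟨1 / 8, by norm_num, 48 + K * K2, by positivity, ?_⟩
  intro N hN hodd α h0 h1 a₁ ha0 haC hsum
  have : NeZero N := ⟨hN.ne_zero⟩
  have hN0 : (0 : ℝ) < N := by exact_mod_cast hN.pos
  obtain ⟨L, hL, hLn⟩ := hpar α h0 h1
  set Y : ℝ := α⁻¹ * Real.log (1 / α) ^ 5 with hY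
  set A : Finset (ZMod N) := Finset.univ.filter (fun z => α / (2 * N) ≤ a₁ z.val) with hA
  have hcardG : Fintype.card (ZMod N) = N := ZMod.card N
  -- density of A
  have hAc : α / (2 * C) * N ≤ A.card := by
    rw [sum_range_zmod] at hsum
    have h2 : ∑ z : ZMod N, a₁ z.val ≤ ∑ z : ZMod N, (α / (2 * N) + C / N * ind A z) := by
      refine Finset.sum_le_sum fun z _ => ?_
      by_cases hz : α / (2 * N) ≤ a₁ z.val
      · have : z ∈ A := by simp [hA, hz]
        have hc := haC _ (ZMod.val_lt z)
        simp only [ind, this, if_true, mul_one]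
        have : 0 ≤ α / (2 * N) := by positivity
        linarith
      · have : z ∉ A := by simpa [hA] using hz
        simp only [ind, this, if_false, mul_zero, add_zero]
        linarith
    rw [Finset.sum_add_distrib, ← Finset.mul_sum, sum_ind, Finset.sum_const, nsmul_eq_mul, Finset.card_univ, hcardG] at h2
    have e1 : (N : ℝ) * (α / (2 * N)) = α / 2 := by field_simp
    rw [e1] at h2
    have h3 : α / 2 ≤ C / N * A.card := by linarith
    have hC0 : 0 < C := by linarith
    have e2 : α / (2 * C) * N = (α / 2) * (N / C) := by field_simp
    have e3 : (A.card : ℝ) = C / N * A.card * (N / C) := by field_simp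
    rw [e2, e3]
    gcongr
  -- halving
  obtain ⟨m, hm⟩ := hodd
  let h : ZMod N →+ ZMod N := AddMonoidHom.mulLeft ((m + 1 : ℕ) : ZMod N)
  have hh : ∀ x, h x + h x = x := by
    intro x
    change ((m + 1 : ℕ) : ZMod N) * x + ((m + 1 : ℕ) : ZMod N) * x = x
    have : ((m + 1 : ℕ) : ZMod N) + ((m + 1 : ℕ) : ZMod N) = 1 := by
      have e1 : ((m + 1 : ℕ) : ZMod N) + ((m + 1 : ℕ) : ZMod N) = ((N + 1 : ℕ) : ZMod N) := by
        rw [← Nat.cast_add]; congr 1; omega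
      rw [e1]; simp
    rw [← add_mul, this, one_mul]
  have hT := hK (ZMod N) h hh A L (by
    rw [hcardG]
    exact le_trans (by gcongr) hAc)
  rw [hcardG] at hT
  have hlam := lam3_ge N a₁ (by positivity : 0 ≤ α / (2 * N)) ha0 A (fun z hz => (Finset.mem_filter.1 hz).2)
  refine le_trans ?_ hlam
  set x := Real.log (1 / α) with hx
  have hlog2 : (1 / 2 : ℝ) < Real.log 2 := by have := Real.log_two_gt_d9; linarith
  have hlog2' : Real.log 2 < 1 := by have := Real.log_two_lt_d9; linarith
  have hx2 : 1 / 2 ≤ x := by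
    refine hlog2.le.trans (Real.log_le_log (by norm_num) ?_)
    rw [le_div_iff₀ h0]; linarith
  have hxY : x ≤ 16 * Y := by
    have h5 : (1 / 2 : ℝ) ^ 4 ≤ x ^ 4 := pow_le_pow_left₀ (by norm_num) hx2 4
    have h6 : 1 ≤ α⁻¹ := by rw [one_le_inv₀ h0]; linarith
    have h7 : x ≤ 16 * x ^ 5 := by
      have : x * (1 / 2 : ℝ) ^ 4 ≤ x * x ^ 4 := by gcongr
      have e : x ^ 5 = x * x ^ 4 := by ring
      rw [e]; norm_num at this; linarith
    have h8 : x ^ 5 ≤ Y := by rw [hY]; exact le_mul_of_one_le_left (by positivity) h6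
    linarith
  have hα3 : Real.exp (-(48 * Y)) ≤ α ^ 3 := by
    have e1 : α ^ 3 = Real.exp (-(3 * x)) := by
      have : α = Real.exp (-x) := by
        rw [hx, Real.exp_neg, Real.exp_log (by positivity), one_div, inv_inv]
      have e3 : Real.exp (-(3 * x)) = Real.exp (-x) ^ 3 := by
        rw [← Real.exp_nat_mul]; congr 1; push_cast; ring
      rw [e3, ← this]
    rw [e1]
    apply Real.exp_le_exp.2
    linarith
  have hexpo : Real.exp (-(K * K2 * Y)) * 2 ^ (K * (L + 1) ^ n) ≤ 1 := by
    have e2 : (2 : ℝ) ^ (K * (L + 1) ^ n) = Real.exp ((K * (L + 1) ^ n : ℕ) * Real.log 2) := by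
      rw [Real.exp_nat_mul, Real.exp_log (by norm_num)]
    rw [e2, ← Real.exp_add]
    apply Real.exp_le_one_iff.2
    push_cast
    have k1 : (K : ℝ) * ((L : ℝ) + 1) ^ n ≤ K * (K2 * Y) := by gcongr
    have k2 : (K : ℝ) * ((L : ℝ) + 1) ^ n * Real.log 2 ≤ K * ((L : ℝ) + 1) ^ n :=
      mul_le_of_le_one_right (by positivity) hlog2'.le
    linarith
  have hT0 := T3_nonneg A
  have hT2 : Real.exp (-(K * K2 * Y)) * (N : ℝ) ^ 2 ≤ T3 A := by
    calc Real.exp (-(K * K2 * Y)) * (N : ℝ) ^ 2 ≤ Real.exp (-(K * K2 * Y)) * (2 ^ (K * (L + 1) ^ n) * T3 A) := by gcongr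
      _ = Real.exp (-(K * K2 * Y)) * 2 ^ (K * (L + 1) ^ n) * T3 A := by ring
      _ ≤ 1 * T3 A := by gcongr
      _ = _ := one_mul _
  have esplit : Real.exp (-(48 + K * K2) * α⁻¹ * x ^ 5) = Real.exp (-(48 * Y)) * Real.exp (-(K * K2 * Y)) := by
    rw [← Real.exp_add]; congr 1; rw [hY]; ring
  rw [esplit]
  calc 1 / 8 * (N : ℝ)⁻¹ * (Real.exp (-(48 * Y)) * Real.exp (-(K * K2 * Y)))
      ≤ 1 / 8 * (N : ℝ)⁻¹ * (α ^ 3 * Real.exp (-(K * K2 * Y))) := by gcongr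
    _ = (α / (2 * N)) ^ 3 * (Real.exp (-(K * K2 * Y)) * (N : ℝ) ^ 2) := by field_simp; ring
    _ ≤ _ := by gcongr
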